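/- Let q = p^r > 2 be a prime power, d ≥ 1, N = (d+1)(q−1), and let M be a matching in the complete graph on the vertex set of the N-simplex σ^N. Then every continuous map f : ‖σ^N‖ → ℝ^d admits q pairwise disjoint faces F₁, …, F_q of σ^N whose images under f have a common point and such that |F_i ∩ e| ≤ 1 for every i ∈ [q] and every edge e ∈ M. -/

import Mathlib

/-- The geometric realization of the face of the standard simplex spanned by
the vertex set `F`: points of the standard simplex supported on `F`. -/
def faceRealization {ι : Type*} [Fintype ι] (F : Finset ι) :
    Set (stdSimplex ℝ ι) :=
  {w | ∀ j : ι, w.1 j ≠ 0 → j ∈ F}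

/-! ### Chains on lists -/

namespace ListChain

variable {k : Type*} [Field k] {V W : Type*}

/-- Prepend `a` to every list of a chain: the cone with apex `a`. -/
noncomputable def cone (a : V) : (List V →₀ k) →ₗ[k] (List V →₀ k) :=
  Finsupp.lmapDomain k k (List.cons a)

@[simp] lemma cone_single (a : V) (l : List V) (c : k) :
    cone a (Finsupp.single l c) = Finsupp.single (a :: l) c := by
  simp [cone]

/-- The boundary of a single list, the empty list being the augmentation generator. -/
noncomputable def bdList (k : Type*) [Field k] : List V → (List V →₀ k)
  | [] => 0
  | a :: l => Finsupp.single l 1 - cone a (bdList k l)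

/-- The augmented simplicial boundary operator on ordered chains. -/
noncomputable def bd : (List V →₀ k) →ₗ[k] (List V →₀ k) :=
  Finsupp.linearCombination k (bdList k)

lemma bd_single (l : List V) : bd (Finsupp.single l (1 : k)) = bdList k l := by
  simp [bd]

lemma bd_cone (a : V) (x : List V →₀ k) : bd (cone a x) = x - cone a (bd x) := by
  have : bd ∘ₗ cone a = LinearMap.id - cone a ∘ₗ bd (k := k) := by
    ext l : 2
    simp [bd, bdList]
  exact LinearMap.congr_fun this x

lemma bd_bdList (l : List V) : bd (bdList k l) = 0 := by
  induction l with
  | nil => simp [bdList]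
  | cons a l ih => rw [bdList, map_sub, bd_single, bd_cone, ih]; simp

lemma bd_bd (x : List V →₀ k) : bd (bd x) = 0 := by
  have : bd ∘ₗ bd = (0 : (List V →₀ k) →ₗ[k] (List V →₀ k)) := by
    ext l : 2
    simp [bd_single, bd_bdList]
  exact LinearMap.congr_fun this x

/-- The chain map induced by a map of vertices. -/
noncomputable def push (f : V → W) : (List V →₀ k) →ₗ[k] (List W →₀ k) :=
  Finsupp.lmapDomain k k (List.map f)

@[simp] lemma push_single (f : V → W) (l : List V) (c : k) :
    push f (Finsupp.single l c) = Finsupp.single (l.map f) c := by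
  simp [push]

lemma push_cone (f : V → W) (a : V) (x : List V →₀ k) :
    push f (cone a x) = cone (f a) (push f x) := by
  have : push f ∘ₗ cone a = cone (f a) ∘ₗ push (k := k) f := by
    ext l : 2
    simp
  exact LinearMap.congr_fun this x

lemma push_bdList (f : V → W) (l : List V) : push f (bdList k l) = bdList k (l.map f) := by
  induction l with
  | nil => simp [bdList]
  | cons a l ih => simp [bdList, push_cone, ih]

lemma bd_push (f : V → W) (x : List V →₀ k) : bd (push f x) = push f (bd x) := by
  have : bd ∘ₗ push f = push f ∘ₗ bd (k := k) := by
    ext l : 2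
    simp [bd_single, push_bdList]
  exact LinearMap.congr_fun this x

/-- A linear map sends chains supported on `s` into `S` as soon as it does so on generators. -/
lemma map_mem_of_supported {ι M : Type*} [AddCommGroup M] [Module k M] {s : Set ι}
    {S : Submodule k M} (F : (ι →₀ k) →ₗ[k] M)
    (h : ∀ i ∈ s, F (Finsupp.single i 1) ∈ S) {x : ι →₀ k}
    (hx : x ∈ Finsupp.supported k k s) : F x ∈ S := by
  rw [Finsupp.supported_eq_span_single] at hx
  have : Submodule.span k ((fun i => Finsupp.single i (1 : k)) '' s) ≤ S.comap F := by
    rw [Submodule.span_le]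
    rintro _ ⟨i, hi, rfl⟩
    exact h i hi
  exact this hx

/-- Linear maps agreeing on the generators in `s` agree on chains supported on `s`. -/
lemma eq_of_supported {ι M : Type*} [AddCommGroup M] [Module k M] {s : Set ι}
    {F F' : (ι →₀ k) →ₗ[k] M}
    (h : ∀ i ∈ s, F (Finsupp.single i 1) = F' (Finsupp.single i 1)) {x : ι →₀ k}
    (hx : x ∈ Finsupp.supported k k s) : F x = F' x := by
  have := map_mem_of_supported (S := (⊥ : Submodule k M)) (F - F')
    (fun i hi => by simp [h i hi]) hx
  simpa [sub_eq_zero] using this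

lemma cone_mem {s t : Set (List V)} {a : V} (h : ∀ l ∈ s, a :: l ∈ t) {x : List V →₀ k}
    (hx : x ∈ Finsupp.supported k k s) : cone a x ∈ Finsupp.supported k k t :=
  map_mem_of_supported _ (fun l hl => by
    rw [cone_single]; exact Finsupp.single_mem_supported k _ (h l hl)) hx

lemma bdList_mem (l : List V) :
    bdList k l ∈ Finsupp.supported k k {l' | l'.length + 1 = l.length ∧ ∀ x ∈ l', x ∈ l} := by
  induction l with
  | nil => exact Submodule.zero_mem _
  | cons a l ih =>
    refine Submodule.sub_mem _ (Finsupp.single_mem_supported k _ ?_) (cone_mem ?_ ih)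
    · exact ⟨rfl, fun x hx => List.mem_cons_of_mem _ hx⟩
    · rintro l' ⟨h1, h2⟩
      refine ⟨by simp [h1], fun x hx => ?_⟩
      rcases List.mem_cons.1 hx with rfl | hx
      · simp
      · exact List.mem_cons_of_mem _ (h2 x hx)

lemma bd_mem_forall {P : V → Prop} {x : List V →₀ k}
    (hx : x ∈ Finsupp.supported k k {l | ∀ v ∈ l, P v}) :
    bd x ∈ Finsupp.supported k k {l | ∀ v ∈ l, P v} := by
  refine map_mem_of_supported _ (fun l hl => ?_) hx
  rw [bd_single]
  refine Finsupp.supported_mono (s := {l' | l'.length + 1 = l.length ∧ ∀ x ∈ l', x ∈ l}) ?_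
    (bdList_mem l)
  exact fun l' hl' v hv => hl v (hl'.2 v hv)

/-! ### Exactness of the complexes built from cones -/

/-- Chains of lists of length `m` in `L`. -/
noncomputable def chains (k : Type*) [Field k] (L : Set (List V)) (m : ℕ) :
    Submodule k (List V →₀ k) :=
  Finsupp.supported k k {l | l ∈ L ∧ l.length = m}

lemma chains_mono {L L' : Set (List V)} (h : L ⊆ L') (m : ℕ) : chains k L m ≤ chains k L' m :=
  Finsupp.supported_mono fun l (hl : l ∈ L ∧ l.length = m) =>
    (⟨h hl.1, hl.2⟩ : l ∈ L' ∧ l.length = m)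

lemma cone_mem_chains {L L' : Set (List V)} {a : V} (h : ∀ l ∈ L, a :: l ∈ L') {m : ℕ}
    {x : List V →₀ k} (hx : x ∈ chains k L m) : cone a x ∈ chains k L' (m + 1) :=
  cone_mem (s := {l | l ∈ L ∧ l.length = m}) (t := {l | l ∈ L' ∧ l.length = m + 1})
    (fun l hl => ⟨h l hl.1, by simp [hl.2]⟩) hx

/-- Every cycle of lists of length `m` in `L` is a boundary in `L`. -/
def ExactAt (k : Type*) [Field k] (L : Set (List V)) (m : ℕ) : Prop :=
  ∀ z ∈ chains k L m, bd z = 0 → ∃ w ∈ chains k L (m + 1), bd w = z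

/-- Attach to `L₀` the cones with apex `a i` over `L i`, for `i ∈ I`. -/
def attach {ι : Type*} (I : Finset ι) (a : ι → V) (L₀ : Set (List V)) (L : ι → Set (List V)) :
    Set (List V) :=
  L₀ ∪ {l | ∃ i ∈ I, ∃ l' ∈ L i, l = a i :: l'}

section attach

variable {ι : Type*} {I : Finset ι} {a : ι → V} {L₀ : Set (List V)} {L : ι → Set (List V)}

lemma cons_mem_attach {i : ι} (hi : i ∈ I) {l : List V} (hl : l ∈ L i) :
    a i :: l ∈ attach I a L₀ L :=
  Or.inr ⟨i, hi, l, hl, rfl⟩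

lemma cone_mem_attach {i : ι} (hi : i ∈ I) {m : ℕ} {x : List V →₀ k} (hx : x ∈ chains k (L i) m) :
    cone (a i) x ∈ chains k (attach I a L₀ L) (m + 1) :=
  cone_mem_chains (fun _ hl => cons_mem_attach hi hl) hx

lemma exists_decomposition {m : ℕ} {z : List V →₀ k}
    (hz : z ∈ chains k (attach I a L₀ L) (m + 1)) :
    ∃ z₀ ∈ chains k L₀ (m + 1), ∃ y : ι → (List V →₀ k),
      (∀ i ∈ I, y i ∈ chains k (L i) m) ∧ z = z₀ + ∑ i ∈ I, cone (a i) (y i) := by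
  classical
  rw [chains, Finsupp.supported_eq_span_single] at hz
  induction hz using Submodule.span_induction with
  | mem x hx =>
    obtain ⟨l, ⟨hl | ⟨i, hi, l', hl', rfl⟩, hlen⟩, rfl⟩ := hx
    · refine ⟨_, Finsupp.single_mem_supported k 1 ⟨hl, hlen⟩, 0, ?_, by simp⟩
      exact fun i _ => Submodule.zero_mem _
    · refine ⟨0, Submodule.zero_mem _, Pi.single i (Finsupp.single l' 1), ?_, ?_⟩
      · intro j _
        by_cases h : j = i
        · subst h
          rw [Pi.single_eq_same]
          exact Finsupp.single_mem_supported k _ ⟨hl', by simpa using hlen⟩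
        · rw [Pi.single_eq_of_ne h]
          exact Submodule.zero_mem _
      · rw [Finset.sum_eq_single i]
        · simp
        · intro j _ h
          rw [Pi.single_eq_of_ne h, map_zero]
        · exact fun h => absurd hi h
  | zero => exact ⟨0, Submodule.zero_mem _, 0, fun i _ => Submodule.zero_mem _, by simp⟩
  | add x x' _ _ h h' =>
    obtain ⟨z₀, hz₀, y, hy, rfl⟩ := h
    obtain ⟨z₀', hz₀', y', hy', rfl⟩ := h'
    refine ⟨z₀ + z₀', Submodule.add_mem _ hz₀ hz₀', y + y',
      fun i hi => Submodule.add_mem _ (hy i hi) (hy' i hi), ?_⟩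
    simp only [Pi.add_apply, map_add, Finset.sum_add_distrib]
    abel
  | smul c x _ h =>
    obtain ⟨z₀, hz₀, y, hy, rfl⟩ := h
    refine ⟨c • z₀, Submodule.smul_mem _ c hz₀, c • y,
      fun i hi => Submodule.smul_mem _ c (hy i hi), ?_⟩
    simp [Finset.smul_sum]

open Classical in
/-- The coefficient chain of the lists starting with `a`. -/
noncomputable def tailAt (a : V) : (List V →₀ k) →ₗ[k] (List V →₀ k) :=
  Finsupp.linearCombination k fun l => match l with
    | [] => 0
    | b :: l' => if b = a then Finsupp.single l' 1 else 0

lemma tailAt_cone_self (a : V) (x : List V →₀ k) : tailAt a (cone a x) = x := by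
  have : tailAt a ∘ₗ cone a = (LinearMap.id : (List V →₀ k) →ₗ[k] _) := by
    ext l : 2
    simp [tailAt]
  exact LinearMap.congr_fun this x

lemma tailAt_cone_of_ne {a b : V} (h : b ≠ a) (x : List V →₀ k) : tailAt a (cone b x) = 0 := by
  have : tailAt a ∘ₗ cone b = (0 : (List V →₀ k) →ₗ[k] _) := by
    ext l : 2
    simp [tailAt, h]
  exact LinearMap.congr_fun this x

lemma tailAt_eq_zero {a : V} {x : List V →₀ k}
    (hx : x ∈ Finsupp.supported k k {l | ∀ v ∈ l, v ≠ a}) : tailAt a x = 0 := by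
  refine eq_of_supported (F' := 0) (fun l hl => ?_) hx
  cases l with
  | nil => simp [tailAt]
  | cons b l => simp [tailAt, hl b (by simp)]

/-- In a cycle the coefficients of the cones are cycles. -/
lemma bd_coeff_eq_zero {m : ℕ} (ha : Set.InjOn a I) (hL : ∀ i ∈ I, L i ⊆ L₀)
    (havoid : ∀ l ∈ L₀, ∀ v ∈ l, ∀ i ∈ I, v ≠ a i)
    {z₀ : List V →₀ k} (hz₀ : z₀ ∈ chains k L₀ (m + 1)) {y : ι → (List V →₀ k)}
    (hy : ∀ i ∈ I, y i ∈ chains k (L i) m)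
    (hz : bd (z₀ + ∑ i ∈ I, cone (a i) (y i)) = 0) {i : ι} (hi : i ∈ I) : bd (y i) = 0 := by
  have hsub : ∀ n, chains k L₀ n ≤ Finsupp.supported k k {l | ∀ v ∈ l, v ≠ a i} := fun n =>
    Finsupp.supported_mono fun l hl v hv => havoid l hl.1 v hv i hi
  have h := congrArg (tailAt (a i)) hz
  simp only [map_add, map_sum, bd_cone, map_sub, map_zero] at h
  rw [tailAt_eq_zero (bd_mem_forall (hsub _ hz₀)), zero_add, Finset.sum_eq_single i] at h
  · rw [tailAt_eq_zero (hsub _ (chains_mono (hL i hi) _ (hy i hi))), tailAt_cone_self] at h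
    simpa using h
  · intro j hj hji
    rw [tailAt_eq_zero (hsub _ (chains_mono (hL j hj) _ (hy j hj))),
      tailAt_cone_of_ne (fun h => hji (ha hj hi h)), sub_zero]
  · exact fun h => absurd hi h

/-- A cycle can be pushed off the attached cones whose bases are exact. -/
lemma exists_homologous_in_base {m : ℕ} (ha : Set.InjOn a I) (hL : ∀ i ∈ I, L i ⊆ L₀)
    (havoid : ∀ l ∈ L₀, ∀ v ∈ l, ∀ i ∈ I, v ≠ a i) (hex : ∀ i ∈ I, ExactAt k (L i) m)
    {z : List V →₀ k} (hz : z ∈ chains k (attach I a L₀ L) (m + 1)) (hbd : bd z = 0) :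
    ∃ z' ∈ chains k L₀ (m + 1), bd z' = 0 ∧
      ∃ w ∈ chains k (attach I a L₀ L) (m + 2), bd w = z - z' := by
  classical
  obtain ⟨z₀, hz₀, y, hy, rfl⟩ := exists_decomposition hz
  have hcyc : ∀ i : I, ∃ w ∈ chains k (L i) (m + 1), bd w = y i := fun i =>
    hex i i.2 _ (hy i i.2) (bd_coeff_eq_zero ha hL havoid hz₀ hy hbd i.2)
  choose u hu hbu using hcyc
  set w : List V →₀ k := -∑ i : I, cone (a i) (u i) with hw
  have hbw : bd w = (z₀ + ∑ i ∈ I, cone (a i) (y i)) - (z₀ + ∑ i : I, u i) := by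
    rw [hw, map_neg, map_sum, ← Finset.sum_coe_sort I]
    simp only [bd_cone, hbu, Finset.sum_sub_distrib]
    abel
  refine ⟨z₀ + ∑ i : I, u i, Submodule.add_mem _ hz₀ (Submodule.sum_mem _ fun i _ =>
    chains_mono (hL i i.2) _ (hu i)), ?_, w, ?_, hbw⟩
  · have := congrArg bd hbw
    rw [bd_bd, map_sub, hbd, zero_sub, eq_comm, neg_eq_zero] at this
    exact this
  · exact Submodule.neg_mem _ (Submodule.sum_mem _ fun i _ =>
      cone_mem_attach i.2 (hu i))

lemma exists_bd_eq_of_cone {L L' : Set (List V)} {b : V} (h : ∀ l ∈ L, b :: l ∈ L') {m : ℕ}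
    {z : List V →₀ k} (hz : z ∈ chains k L m) (hbd : bd z = 0) :
    ∃ w ∈ chains k L' (m + 1), bd w = z :=
  ⟨cone b z, cone_mem_chains h hz, by simp [bd_cone, hbd]⟩

lemma chains_attach_zero : chains k (attach I a L₀ L) 0 ≤ chains k L₀ 0 := by
  refine Finsupp.supported_mono ?_
  rintro l ⟨hl | ⟨i, hi, l', hl', rfl⟩, hlen⟩
  · exact ⟨hl, hlen⟩
  · simp at hlen

end attach

/-- Joining with a nonempty discrete set raises exactness by one degree. -/
lemma exactAt_join_points {ι : Type*} {I : Finset ι} {a : ι → V} {L : Set (List V)}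
    (ha : Set.InjOn a I) (hI : I.Nonempty) (havoid : ∀ l ∈ L, ∀ v ∈ l, ∀ i ∈ I, v ≠ a i)
    {n : ℕ} (hex : ∀ m < n, ExactAt k L m) {m : ℕ} (hm : m < n + 1) :
    ExactAt k (attach I a L fun _ => L) m := by
  obtain ⟨i, hi⟩ := hI
  have hcone : ∀ l ∈ L, a i :: l ∈ attach I a L fun _ => L := fun l hl => cons_mem_attach hi hl
  intro z hz hbd
  cases m with
  | zero => exact exists_bd_eq_of_cone hcone (chains_attach_zero hz) hbd
  | succ m =>
    obtain ⟨z', hz', hbd', w, hw, hbw⟩ := exists_homologous_in_base ha (fun _ _ => subset_rfl)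
      havoid (fun _ _ => hex m (by omega)) hz hbd
    obtain ⟨w', hw', hbw'⟩ := exists_bd_eq_of_cone hcone hz' hbd'
    exact ⟨w + w', Submodule.add_mem _ hw hw', by rw [map_add, hbw, hbw']; abel⟩

/-- The join of `L` with the chessboard complex on two rows `a`, `b`. -/
def joinChessboard {ι : Type*} [Fintype ι] [DecidableEq ι] (a b : ι → V) (L : Set (List V)) :
    Set (List V) :=
  attach Finset.univ a (attach Finset.univ b L fun _ => L)
    fun i => attach (Finset.univ.erase i) b L fun _ => L

/-- Joining with a chessboard complex with two rows and at least three columns raises exactness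
by two degrees. -/
lemma exactAt_joinChessboard {ι : Type*} [Fintype ι] [DecidableEq ι] {a b : ι → V}
    {L : Set (List V)} (ha : a.Injective) (hb : b.Injective) (hab : ∀ i j, a i ≠ b j)
    (havoida : ∀ l ∈ L, ∀ v ∈ l, ∀ i, v ≠ a i) (havoidb : ∀ l ∈ L, ∀ v ∈ l, ∀ i, v ≠ b i)
    (hι : 2 < Fintype.card ι) {n : ℕ} (hex : ∀ m < n, ExactAt k L m) {m : ℕ} (hm : m < n + 2) :
    ExactAt k (joinChessboard a b L) m := by
  obtain ⟨j₀⟩ : Nonempty ι := Fintype.card_pos_iff.1 (by omega)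
  have hbase : attach Finset.univ b L (fun _ => L) ⊆ joinChessboard a b L :=
    Set.subset_union_left
  intro z hz hbd
  cases m with
  | zero =>
    exact exists_bd_eq_of_cone (fun l hl => hbase (cons_mem_attach (Finset.mem_univ j₀) hl))
      (chains_attach_zero (chains_attach_zero hz)) hbd
  | succ m =>
    have hsub : ∀ i ∈ (Finset.univ : Finset ι), attach (Finset.univ.erase i) b L (fun _ => L) ⊆
        attach Finset.univ b L fun _ => L := by
      rintro i - l (hl | ⟨j, -, l', hl', rfl⟩)
      · exact Or.inl hl
      · exact cons_mem_attach (Finset.mem_univ j) hl'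
    have havoid : ∀ l ∈ attach Finset.univ b L (fun _ => L), ∀ v ∈ l,
        ∀ i ∈ (Finset.univ : Finset ι), v ≠ a i := by
      rintro l (hl | ⟨j, -, l', hl', rfl⟩) v hv i -
      · exact havoida l hl v hv i
      · rcases List.mem_cons.1 hv with rfl | hv
        · exact (hab i j).symm
        · exact havoida l' hl' v hv i
    have hexi : ∀ i ∈ (Finset.univ : Finset ι),
        ExactAt k (attach (Finset.univ.erase i) b L fun _ => L) m := by
      intro i _
      refine exactAt_join_points hb.injOn ?_ (fun l hl v hv j _ => havoidb l hl v hv j) hex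
        (by omega)
      rw [← Finset.card_pos, Finset.card_erase_of_mem (Finset.mem_univ i), Finset.card_univ]
      omega
    obtain ⟨z', hz', hbd', w, hw, hbw⟩ := exists_homologous_in_base ha.injOn hsub havoid hexi hz hbd
    obtain ⟨z₀, hz₀, y, hy, rfl⟩ := exists_decomposition hz'
    have hcyc : ∀ j, bd (y j) = 0 := fun j =>
      bd_coeff_eq_zero hb.injOn (fun _ _ => subset_rfl)
        (fun l hl v hv i _ => havoidb l hl v hv i) hz₀ hy hbd' (Finset.mem_univ j)
    have hthird : ∀ j : ι, ∃ i, i ≠ j ∧ i ≠ j₀ := by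
      intro j
      obtain ⟨i, hi⟩ := Finset.exists_mem_notMem_of_card_lt_card
        (s := {j, j₀}) (t := (Finset.univ : Finset ι))
        (lt_of_le_of_lt Finset.card_le_two (by simpa using hι))
      exact ⟨i, by simpa using hi.2⟩
    choose i hij hi₀ using hthird
    refine ⟨w + cone (b j₀) z₀ +
      ∑ j, cone (a (i j)) (cone (b j) (y j) - cone (b j₀) (y j)), ?_, ?_⟩
    · refine Submodule.add_mem _ (Submodule.add_mem _ hw ?_) (Submodule.sum_mem _ fun j _ => ?_)
      · exact chains_mono hbase _ (cone_mem_attach (L := fun _ => L) (Finset.mem_univ j₀) hz₀)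
      · have hmem : ∀ j', i j ≠ j' → cone (b j') (y j) ∈
            chains k (attach (Finset.univ.erase (i j)) b L fun _ => L) (m + 1) := fun j' hj' =>
          cone_mem_attach (L := fun _ => L) (Finset.mem_erase.2 ⟨hj'.symm, Finset.mem_univ _⟩)
            (hy j (Finset.mem_univ j))
        exact cone_mem_attach (L := fun i => attach (Finset.univ.erase i) b L fun _ => L)
          (Finset.mem_univ (i j)) (Submodule.sub_mem _ (hmem j (hij j)) (hmem j₀ (hi₀ j)))
    · have hsum : bd z₀ = -∑ j, y j := by
        simp only [map_add, map_sum, bd_cone, hcyc, map_zero, sub_zero] at hbd'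
        exact eq_neg_of_add_eq_zero_left hbd'
      simp only [map_add, map_sum, bd_cone, hbw, map_sub, hcyc, hsum, map_neg, map_zero, sub_zero,
        Finset.sum_sub_distrib]
      abel

end ListChain

/-! ### Barycentric subdivision of affine chains -/

namespace ListChain

section subdivision

variable {k : Type*} [Field k] {E : Type*} [NormedAddCommGroup E] [NormedSpace ℝ E]

/-- The barycenter of a list of points. -/
noncomputable def barycenter (l : List E) : E := (l.length : ℝ)⁻¹ • l.sum

/-- Barycentric subdivision of a list of points, with recursion depth `n`. -/
noncomputable def sdAux (k : Type*) [Field k] : ℕ → List E → (List E →₀ k)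
  | 0, l => Finsupp.single l 1
  | n + 1, l => cone (barycenter l) (Finsupp.linearCombination k (sdAux k n) (bdList k l))

/-- Barycentric subdivision of affine chains. -/
noncomputable def sd : (List E →₀ k) →ₗ[k] (List E →₀ k) :=
  Finsupp.linearCombination k fun l => sdAux k l.length l

lemma sd_nil : sd (Finsupp.single ([] : List E) (1 : k)) = Finsupp.single [] 1 := by
  simp [sd, sdAux]

lemma sd_single {l : List E} (hl : l ≠ []) :
    sd (Finsupp.single l (1 : k)) = cone (barycenter l) (sd (bdList k l)) := by
  obtain ⟨n, hn⟩ : ∃ n, l.length = n + 1 :=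
    ⟨l.length - 1, by have := List.length_pos_iff.2 hl; omega⟩
  have : sd (bdList k l) = Finsupp.linearCombination k (sdAux k n) (bdList k l) := by
    refine eq_of_supported (fun l' hl' => ?_) (bdList_mem l)
    have : l'.length = n := by have := hl'.1; omega
    simp [sd, this]
  rw [this]
  simp [sd, hn, sdAux]

/-- Induction along faces: a property of lists holds if it is inherited from the proper faces. -/
lemma face_induction {α : Type*} {P : List α → Prop} (hnil : P [])
    (h : ∀ l, l ≠ [] → (∀ l' : List α, l'.length + 1 = l.length → (∀ x ∈ l', x ∈ l) → P l') → P l)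
    (l : List α) : P l := by
  induction hn : l.length generalizing l with
  | zero => rwa [List.length_eq_zero_iff.1 hn]
  | succ n ih =>
    exact h l (by rintro rfl; simp at hn) fun l' hl' _ => ih l' (by omega)

lemma bd_sd (x : List E →₀ k) : bd (sd x) = sd (bd x) := by
  suffices ∀ l : List E, bd (sd (Finsupp.single l (1 : k))) = sd (bdList k l) by
    have : bd ∘ₗ sd = sd ∘ₗ (bd : (List E →₀ k) →ₗ[k] _) := by
      ext l : 2
      simp [bd_single, this]
    exact LinearMap.congr_fun this x
  refine face_induction ?_ fun l hl ih => ?_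
  · simp [sd_nil, bd_single, bdList]
  · have h : bd (sd (bdList k l)) = sd (bd (bdList k l)) :=
      eq_of_supported (F := bd ∘ₗ sd) (F' := sd ∘ₗ bd)
        (fun l' hl' => by simpa [bd_single] using ih l' hl'.1 hl'.2) (bdList_mem l)
    rw [sd_single hl, bd_cone, h, bd_bdList]
    simp

/-- Subdivision commutes with linear maps. -/
lemma sd_push (A : E →ₗ[ℝ] E) (x : List E →₀ k) : sd (push A x) = push A (sd x) := by
  suffices ∀ l : List E, sd (Finsupp.single (l.map A) (1 : k)) =
      push A (sd (Finsupp.single l 1)) by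
    have : sd ∘ₗ push A = push A ∘ₗ sd (k := k) := by
      ext l : 2
      simp [this]
    exact LinearMap.congr_fun this x
  refine face_induction (by simp [sd_nil]) fun l hl ih => ?_
  have h : sd (push A (bdList k l)) = push A (sd (bdList k l)) :=
    eq_of_supported (F := sd ∘ₗ push A) (F' := push A ∘ₗ sd)
      (fun l' hl' => by simpa using ih l' hl'.1 hl'.2) (bdList_mem l)
  have hb : barycenter (l.map A) = A (barycenter l) := by
    simp [barycenter, map_list_sum]
  rw [sd_single hl, sd_single (by simpa using hl), push_cone, ← h, push_bdList, hb]

lemma sd_pow_nil (j : ℕ) : (sd ^ j : Module.End k (List E →₀ k)) (Finsupp.single [] 1) =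
    Finsupp.single [] 1 := by
  induction j with
  | zero => simp
  | succ j ih => rw [pow_succ', Module.End.mul_apply, ih, sd_nil]

lemma bd_sd_pow (j : ℕ) (x : List E →₀ k) :
    bd ((sd ^ j : Module.End k (List E →₀ k)) x) = (sd ^ j : Module.End k _) (bd x) := by
  induction j with
  | zero => simp
  | succ j ih => rw [pow_succ', Module.End.mul_apply, Module.End.mul_apply, bd_sd, ih]

lemma sd_pow_push (j : ℕ) (A : E →ₗ[ℝ] E) (x : List E →₀ k) :
    (sd ^ j : Module.End k (List E →₀ k)) (push A x) = push A ((sd ^ j : Module.End k _) x) := by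
  induction j with
  | zero => simp
  | succ j ih => rw [pow_succ', Module.End.mul_apply, Module.End.mul_apply, ih, sd_push]

lemma barycenter_mem {C : Set E} (hC : Convex ℝ C) {l : List E} (hl : l ≠ [])
    (h : ∀ x ∈ l, x ∈ C) : barycenter l ∈ C := by
  have hpos : (0 : ℝ) < l.length := by exact_mod_cast List.length_pos_iff.2 hl
  have : barycenter l = ∑ i : Fin l.length, (l.length : ℝ)⁻¹ • l[i] := by
    rw [← Finset.smul_sum, barycenter, ← Fin.sum_univ_getElem]
    rfl
  rw [this]
  refine hC.sum_mem (fun _ _ => by positivity) ?_ fun i _ => h _ (List.getElem_mem _)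
  simp [hpos.ne']

lemma dist_barycenter_le {l : List E} {n : ℕ} (hn : l.length ≤ n + 1) {D : ℝ}
    (hD : ∀ x ∈ l, ∀ y ∈ l, dist x y ≤ D) {y : E} (hy : y ∈ l) :
    dist y (barycenter l) ≤ (n / (n + 1) : ℝ) * D := by
  obtain ⟨i, rfl⟩ := List.get_of_mem hy
  have hlen : 0 < l.length := i.pos
  have hpos : (0 : ℝ) < l.length := by exact_mod_cast hlen
  have hD0 : 0 ≤ D := by simpa using hD _ hy _ hy
  have h1 : l.get i - barycenter l =
      ∑ j ∈ Finset.univ.erase i, (l.length : ℝ)⁻¹ • (l.get i - l.get j) := by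
    have hsum : l.sum = ∑ j, l.get j := (Fin.sum_univ_getElem l).symm
    rw [Finset.sum_erase _ (by simp), ← Finset.smul_sum, Finset.sum_sub_distrib, barycenter, hsum,
      smul_sub, Finset.sum_const, Finset.card_univ, Fintype.card_fin, ← Nat.cast_smul_eq_nsmul ℝ,
      inv_smul_smul₀ hpos.ne']
  rw [dist_eq_norm, h1]
  calc _ ≤ ∑ j ∈ Finset.univ.erase i, (l.length : ℝ)⁻¹ * D := by
        refine norm_sum_le_of_le _ fun j _ => ?_
        rw [norm_smul, Real.norm_of_nonneg (by positivity), ← dist_eq_norm]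
        gcongr
        exact hD _ hy _ (List.get_mem _ _)
    _ = ((l.length - 1 : ℝ) / l.length) * D := by
        rw [Finset.sum_const, Finset.card_erase_of_mem (Finset.mem_univ i), Finset.card_univ,
          Fintype.card_fin, nsmul_eq_mul, Nat.cast_sub hlen]
        push_cast; ring
    _ ≤ _ := by
        refine mul_le_mul_of_nonneg_right ?_ hD0
        rw [div_le_div_iff₀ hpos (by positivity)]
        have : (l.length : ℝ) ≤ n + 1 := by exact_mod_cast hn
        nlinarith

/-- Subdivision keeps chains inside convex sets, preserves lengths and contracts diameters. -/
lemma sd_mem_small {n : ℕ} {C : Set E} (hC : Convex ℝ C) {D : ℝ} (l : List E)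
    (hn : l.length ≤ n + 1) (hlC : ∀ x ∈ l, x ∈ C) (hD : ∀ x ∈ l, ∀ y ∈ l, dist x y ≤ D) :
    sd (Finsupp.single l (1 : k)) ∈ Finsupp.supported k k {l' | l'.length = l.length ∧
      (∀ x ∈ l', x ∈ C) ∧ ∀ x ∈ l', ∀ y ∈ l', dist x y ≤ (n / (n + 1) : ℝ) * D} := by
  induction l using face_induction generalizing C with
  | hnil => rw [sd_nil]; exact Finsupp.single_mem_supported k _ (by simp)
  | h l hl ih =>
    obtain ⟨v, hv⟩ := List.exists_mem_of_ne_nil l hl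
    have hD0 : 0 ≤ D := by simpa using hD v hv v hv
    set H := convexHull ℝ {x | x ∈ l}
    have hHC : H ⊆ C := convexHull_min hlC hC
    have hbd : sd (bdList k l) ∈ Finsupp.supported k k {l' | l'.length + 1 = l.length ∧
        (∀ x ∈ l', x ∈ H) ∧ ∀ x ∈ l', ∀ y ∈ l', dist x y ≤ (n / (n + 1) : ℝ) * D} := by
      refine map_mem_of_supported _ (fun l' hl' => ?_) (bdList_mem l)
      refine Finsupp.supported_mono ?_ (ih l' hl'.1 hl'.2 (convex_convexHull ℝ {x | x ∈ l})
        (by have := hl'.1; omega)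
        (fun x hx => subset_convexHull ℝ _ (hl'.2 x hx))
        fun x hx y hy => hD x (hl'.2 x hx) y (hl'.2 y hy))
      rintro l'' ⟨h1, h2, h3⟩
      exact ⟨by have := hl'.1; omega, h2, h3⟩
    have hdist : ∀ x ∈ H, dist x (barycenter l) ≤ (n / (n + 1) : ℝ) * D := fun x hx =>
      convexHull_min (t := Metric.closedBall (barycenter l) ((n / (n + 1) : ℝ) * D))
        (fun y hy => dist_barycenter_le hn hD hy) (convex_closedBall _ _) hx
    rw [sd_single hl]
    refine cone_mem (fun l' hl' => ?_) hbd
    obtain ⟨h1, h2, h3⟩ := hl'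
    refine ⟨by simp [h1], ?_, ?_⟩
    · intro x hx
      rcases List.mem_cons.1 hx with rfl | hx
      · exact barycenter_mem hC hl hlC
      · exact hHC (h2 x hx)
    · intro x hx y hy
      rcases List.mem_cons.1 hx with rfl | hx <;> rcases List.mem_cons.1 hy with rfl | hy
      · rw [dist_self]; positivity
      · rw [dist_comm]; exact hdist y (h2 y hy)
      · exact hdist x (h2 x hx)
      · exact h3 x hx y hy

lemma sd_iterate_mem_small {n : ℕ} {C : Set E} (hC : Convex ℝ C) {D : ℝ} {l : List E}
    (hn : l.length ≤ n + 1) (hlC : ∀ x ∈ l, x ∈ C) (hD : ∀ x ∈ l, ∀ y ∈ l, dist x y ≤ D) (j : ℕ) :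
    (sd ^ j : Module.End k (List E →₀ k)) (Finsupp.single l 1) ∈
      Finsupp.supported k k {l' | l'.length = l.length ∧
        (∀ x ∈ l', x ∈ C) ∧ ∀ x ∈ l', ∀ y ∈ l', dist x y ≤ (n / (n + 1) : ℝ) ^ j * D} := by
  induction j with
  | zero => exact Finsupp.single_mem_supported k _ ⟨rfl, hlC, by simpa using hD⟩
  | succ j ih =>
    rw [pow_succ' sd, Module.End.mul_apply]
    refine map_mem_of_supported _ (fun l' hl' => ?_) ih
    obtain ⟨h1, h2, h3⟩ := hl'
    have := sd_mem_small (k := k) hC l' (h1.trans_le hn) h2 h3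
    rw [← mul_assoc, ← pow_succ', h1] at this
    exact this

end subdivision

end ListChain

/-! ### Alternating functions on lists -/

namespace ListChain

variable {k : Type*} [Field k] {Ω Ω' : Type*}

open Classical in
/-- Signed insertion of `a` into a function on lists. -/
noncomputable def insertSigned (a : Ω) (c : List Ω → k) : List Ω → k
  | [] => 0
  | b :: l => (if b = a then c l else 0) - insertSigned a (fun l' => c (b :: l')) l

/-- Signed insertion as a linear map. -/
noncomputable def insertLin (a : Ω) : (List Ω → k) →ₗ[k] (List Ω → k) where
  toFun := insertSigned a
  map_add' c c' := by
    ext l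
    induction l generalizing c c' with
    | nil => simp [insertSigned]
    | cons b l ih =>
      have := ih (fun l' => c (b :: l')) fun l' => c' (b :: l')
      simp only [Pi.add_apply] at this
      simp only [insertSigned, Pi.add_apply]
      erw [this]
      split_ifs <;> ring
  map_smul' s c := by
    ext l
    induction l generalizing c with
    | nil => simp [insertSigned]
    | cons b l ih =>
      have := ih fun l' => c (b :: l')
      simp only [Pi.smul_apply, RingHom.id_apply] at this
      simp only [insertSigned, Pi.smul_apply, RingHom.id_apply]
      erw [this]
      split_ifs <;> simp [mul_sub]

open Classical in
lemma insertLin_cons (a b : Ω) (c : List Ω → k) (l : List Ω) : insertLin a c (b :: l) =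
    (if b = a then c l else 0) - insertLin a (fun l' => c (b :: l')) l := by
  simp [insertLin, insertSigned]

open Classical in
/-- The antisymmetrization of a list. -/
noncomputable def altList (k : Type*) [Field k] : List Ω → List Ω → k
  | [] => Pi.single [] 1
  | a :: l => insertLin a (altList k l)

/-- The antisymmetrization of chains. -/
noncomputable def alt : (List Ω →₀ k) →ₗ[k] (List Ω → k) :=
  Finsupp.linearCombination k (altList k)

lemma alt_single (l : List Ω) : alt (Finsupp.single l (1 : k)) = altList k l := by
  simp [alt]

lemma alt_cone (a : Ω) (x : List Ω →₀ k) : alt (cone a x) = insertLin a (alt x) := by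
  have : alt ∘ₗ cone a = insertLin a ∘ₗ alt (k := k) := by
    ext l : 2
    simp [alt_single, altList]
  exact LinearMap.congr_fun this x

/-- The boundary operator on alternating functions. -/
def sumHead (k : Type*) [Field k] [Fintype Ω] : (List Ω → k) →ₗ[k] (List Ω → k) where
  toFun c l := ∑ v, c (v :: l)
  map_add' c c' := by ext l; simp [Finset.sum_add_distrib]
  map_smul' s c := by ext l; simp [Finset.mul_sum]

lemma sumHead_apply [Fintype Ω] (c : List Ω → k) (l : List Ω) :
    sumHead k c l = ∑ v, c (v :: l) := rfl

lemma sumHead_insertLin [Fintype Ω] (a : Ω) (c : List Ω → k) :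
    sumHead k (insertLin a c) = c - insertLin a (sumHead k c) := by
  classical
  ext l
  have h2 : sumHead k c = ∑ v, fun l' => c (v :: l') := by
    ext l'
    simp [sumHead_apply]
  rw [Pi.sub_apply, sumHead_apply, h2, map_sum, Finset.sum_apply]
  simp only [insertLin_cons, Finset.sum_sub_distrib]
  rw [Fintype.sum_eq_single a fun v hv => if_neg hv, if_pos rfl]

lemma sumHead_alt [Fintype Ω] (x : List Ω →₀ k) : sumHead k (alt x) = alt (bd x) := by
  suffices ∀ l : List Ω, sumHead k (altList k l) = alt (bdList k l) by
    have : sumHead k ∘ₗ alt = alt ∘ₗ (bd : (List Ω →₀ k) →ₗ[k] _) := by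
      ext l : 2
      simp [alt_single, bd_single, this]
    exact LinearMap.congr_fun this x
  intro l
  induction l with
  | nil => ext l; simp [sumHead_apply, altList, bdList]
  | cons a l ih => rw [altList, sumHead_insertLin, ih, bdList, map_sub, alt_single, alt_cone]

/-- A function on lists is alternating: it changes sign under adjacent transpositions and vanishes
on lists with two equal adjacent entries. -/
def IsAlt (c : List Ω → k) : Prop :=
  (∀ l₁ v w l₂, c (l₁ ++ v :: w :: l₂) = -c (l₁ ++ w :: v :: l₂)) ∧
    ∀ l₁ v l₂, c (l₁ ++ v :: v :: l₂) = 0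

lemma IsAlt.cons {c : List Ω → k} (hc : IsAlt c) (u : Ω) : IsAlt fun l => c (u :: l) :=
  ⟨fun l₁ v w l₂ => hc.1 (u :: l₁) v w l₂, fun l₁ v l₂ => hc.2 (u :: l₁) v l₂⟩

lemma IsAlt.insertLin {c : List Ω → k} (hc : IsAlt c) (a : Ω) : IsAlt (insertLin a c) := by
  constructor
  · intro l₁ v w l₂
    induction l₁ generalizing c with
    | nil =>
      have h : (fun l' => c (v :: w :: l')) = -fun l' => c (w :: v :: l') := by
        ext l'; exact hc.1 [] v w l'
      simp only [List.nil_append, insertLin_cons, h, map_neg, Pi.neg_apply]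
      ring
    | cons u l₁ ih =>
      have h : c (l₁ ++ v :: w :: l₂) = -c (l₁ ++ w :: v :: l₂) := hc.1 l₁ v w l₂
      simp only [List.cons_append, insertLin_cons, ih (hc.cons u), h]
      split_ifs <;> ring
  · intro l₁ v l₂
    induction l₁ generalizing c with
    | nil =>
      have h : (fun l' => c (v :: v :: l')) = 0 := by
        ext l'; exact hc.2 [] v l'
      simp only [List.nil_append, insertLin_cons, h, map_zero, Pi.zero_apply]
      ring
    | cons u l₁ ih =>
      simp [List.cons_append, insertLin_cons, ih (hc.cons u), hc.2 l₁ v l₂]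

lemma isAlt_altList (l : List Ω) : IsAlt (altList k l) := by
  induction l with
  | nil => constructor <;> intros <;> simp [altList]
  | cons a l ih => exact ih.insertLin a

lemma perm_of_insertLin_ne_zero {a : Ω} {c : List Ω → k} {l : List Ω}
    (h : insertLin a c l ≠ 0) : ∃ l', c l' ≠ 0 ∧ l.Perm (a :: l') := by
  induction l generalizing c with
  | nil => simp [insertLin, insertSigned] at h
  | cons b l ih =>
    by_cases h' : insertLin a (fun l' => c (b :: l')) l = 0
    · rw [insertLin_cons, h', sub_zero] at h
      split_ifs at h with hb
      · exact ⟨l, h, by rw [hb]⟩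
      · exact absurd rfl h
    · obtain ⟨l', hl', hp⟩ := ih h'
      exact ⟨b :: l', hl', (hp.cons b).trans (List.Perm.swap _ _ _)⟩

lemma perm_of_altList_ne_zero {l l' : List Ω} (h : altList k l l' ≠ 0) : l'.Perm l := by
  induction l generalizing l' with
  | nil =>
    by_cases h' : l' = []
    · rw [h']
    · classical exact absurd (Pi.single_eq_of_ne h' 1) h
  | cons a l ih =>
    obtain ⟨l'', h'', hp⟩ := perm_of_insertLin_ne_zero h
    exact hp.trans ((ih h'').cons a)

lemma IsAlt.nodup {c : List Ω → k} (hc : IsAlt c) {l : List Ω} (h : c l ≠ 0) : l.Nodup := by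
  have key : ∀ (s l₁ : List Ω) (v : Ω) (t : List Ω), c (l₁ ++ v :: (s ++ v :: t)) = 0 := by
    intro s
    induction s with
    | nil => intro l₁ v t; exact hc.2 l₁ v t
    | cons w s ih =>
      intro l₁ v t
      rw [List.cons_append, hc.1, neg_eq_zero]
      simpa using ih (l₁ ++ [w]) v t
  induction l generalizing c with
  | nil => simp
  | cons a l ih =>
    refine List.nodup_cons.2 ⟨fun ha => ?_, ih (hc.cons a) h fun s l₁ v t => key s (a :: l₁) v t⟩
    obtain ⟨s, t, rfl⟩ := List.append_of_mem ha
    exact h (key s [] a t)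

lemma insertLin_map {σ : Ω → Ω'} (hσ : σ.Injective) (a : Ω) (c : List Ω' → k) (l : List Ω) :
    insertLin (σ a) c (l.map σ) = insertLin a (fun l' => c (l'.map σ)) l := by
  induction l generalizing c with
  | nil => simp [insertLin, insertSigned]
  | cons b l ih => by_cases h : b = a <;> simp [insertLin_cons, ih, hσ.eq_iff, h]

lemma altList_map {σ : Ω → Ω'} (hσ : σ.Injective) (l l' : List Ω) :
    altList k (l.map σ) (l'.map σ) = altList k l l' := by
  induction l generalizing l' with
  | nil =>
    by_cases h : l' = []
    · simp [h, altList]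
    · classical
      rw [List.map_nil, altList, altList, Pi.single_eq_of_ne h,
        Pi.single_eq_of_ne (by simpa using h)]
  | cons a l ih =>
    simp only [List.map_cons, altList, insertLin_map hσ, ih]

lemma alt_push (σ : Ω ≃ Ω') (x : List Ω →₀ k) (l : List Ω') :
    alt (push σ x) l = alt x (l.map σ.symm) := by
  have : LinearMap.proj l ∘ₗ alt ∘ₗ push σ =
      LinearMap.proj (l.map σ.symm) ∘ₗ alt (k := k) := by
    ext l' : 2
    have := altList_map (k := k) σ.injective l' (l.map σ.symm)
    simpa [alt_single] using this
  exact LinearMap.congr_fun this x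

lemma sumHead_sumHead [Fintype Ω] {c : List Ω → k} (hc : IsAlt c) :
    sumHead k (sumHead k c) = 0 := by
  ext l
  simp only [sumHead_apply, Pi.zero_apply]
  rw [← Finset.sum_product']
  refine Finset.sum_involution (fun x _ => x.swap) ?_ ?_ (by simp) (by simp)
  · rintro ⟨v, w⟩ -
    simpa [add_eq_zero_iff_eq_neg] using hc.1 [] w v l
  · rintro ⟨v, w⟩ - h heq
    obtain rfl : w = v := congrArg Prod.fst heq
    exact h (hc.2 [] w l)

/-- Precomposition with a map of vertices. -/
def pull (k : Type*) [Field k] (σ : Ω → Ω) : Module.End k (List Ω → k) where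
  toFun c l := c (l.map σ)
  map_add' c c' := by ext l; simp
  map_smul' s c := by ext l; simp

lemma pull_apply (σ : Ω → Ω) (c : List Ω → k) (l : List Ω) : pull k σ c l = c (l.map σ) := rfl

/-- Alternating functions on lists of length `m` whose set of entries belongs to `K`. -/
def altChains (k : Type*) [Field k] [DecidableEq Ω] (K : Set (Finset Ω)) (m : ℕ) :
    Submodule k (List Ω → k) where
  carrier := {c | IsAlt c ∧ ∀ l, c l ≠ 0 → l.length = m ∧ l.toFinset ∈ K}
  zero_mem' := ⟨⟨by simp, by simp⟩, by simp⟩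
  add_mem' {c c'} hc hc' := by
    refine ⟨⟨fun l₁ v w l₂ => ?_, fun l₁ v l₂ => ?_⟩, fun l hl => ?_⟩
    · simp only [Pi.add_apply, hc.1.1 l₁ v w, hc'.1.1 l₁ v w]; ring
    · simp [hc.1.2, hc'.1.2]
    · by_cases h : c l = 0
      · exact hc'.2 l fun h' => hl (by simp [h, h'])
      · exact hc.2 l h
  smul_mem' s c hc := by
    refine ⟨⟨fun l₁ v w l₂ => ?_, fun l₁ v l₂ => ?_⟩, fun l hl => hc.2 l fun h => hl (by simp [h])⟩
    · simp only [Pi.smul_apply, hc.1.1 l₁ v w, smul_neg]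
    · simp [hc.1.2]

section altChains

variable [DecidableEq Ω] {K : Set (Finset Ω)} {m : ℕ}

lemma sumHead_mem_altChains [Fintype Ω] (hK : ∀ S ∈ K, ∀ T ⊆ S, T ∈ K) {c : List Ω → k}
    (hc : c ∈ altChains k K (m + 1)) : sumHead k c ∈ altChains k K m := by
  refine ⟨⟨fun l₁ v w l₂ => ?_, fun l₁ v l₂ => ?_⟩, fun l hl => ?_⟩
  · simp only [sumHead_apply, ← Finset.sum_neg_distrib]
    exact Finset.sum_congr rfl fun u _ => hc.1.1 (u :: l₁) v w l₂
  · exact Finset.sum_eq_zero fun u _ => hc.1.2 (u :: l₁) v l₂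
  · obtain ⟨u, -, hu⟩ := Finset.exists_ne_zero_of_sum_ne_zero hl
    obtain ⟨h1, h2⟩ := hc.2 _ hu
    exact ⟨by simpa using h1, hK _ h2 _ (by simp)⟩

lemma eq_zero_of_mem_altChains (hK : ∀ S ∈ K, S.card < m) {c : List Ω → k}
    (hc : c ∈ altChains k K m) : c = 0 := by
  ext l
  by_contra h
  obtain ⟨h1, h2⟩ := hc.2 l h
  have := hK _ h2
  rw [List.toFinset_card_of_nodup (hc.1.nodup h), h1] at this
  exact this.false

lemma altList_mem_altChains {l : List Ω} (hl : l.toFinset ∈ K) :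
    altList k l ∈ altChains k K l.length := by
  refine ⟨isAlt_altList l, fun l' h => ?_⟩
  have hp := perm_of_altList_ne_zero h
  exact ⟨hp.length_eq, by rwa [List.toFinset_eq_of_perm _ _ hp]⟩

/-- Multiplication by a function of the set of entries. -/
def mulByFinset (k : Type*) [Field k] (ψ : Finset Ω → k) : Module.End k (List Ω → k) where
  toFun c l := ψ l.toFinset * c l
  map_add' c c' := by ext l; simp [mul_add]
  map_smul' s c := by ext l; simp [mul_left_comm]

lemma mulByFinset_apply (ψ : Finset Ω → k) (c : List Ω → k) (l : List Ω) :
    mulByFinset k ψ c l = ψ l.toFinset * c l := rfl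

lemma mulByFinset_mem_altChains (ψ : Finset Ω → k) {c : List Ω → k} (hc : c ∈ altChains k K m) :
    mulByFinset k ψ c ∈ altChains k K m := by
  refine ⟨⟨fun l₁ v w l₂ => ?_, fun l₁ v l₂ => ?_⟩, fun l hl => ?_⟩
  · rw [mulByFinset_apply, mulByFinset_apply, hc.1.1, List.toFinset_eq_of_perm _ (l₁ ++ w :: v :: l₂)]
    · ring
    · exact (List.Perm.swap _ _ _).append_left l₁
  · rw [mulByFinset_apply, hc.1.2, mul_zero]
  · exact hc.2 l fun h => hl (by rw [mulByFinset_apply, h, mul_zero])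

lemma pull_mem_altChains {σ : Ω → Ω} (hσ : ∀ S : Finset Ω, S.image σ ∈ K → S ∈ K)
    {c : List Ω → k} (hc : c ∈ altChains k K m) : pull k σ c ∈ altChains k K m := by
  refine ⟨⟨fun l₁ v w l₂ => ?_, fun l₁ v l₂ => ?_⟩, fun l hl => ?_⟩
  · simp only [pull_apply, List.map_append, List.map_cons]
    exact hc.1.1 _ _ _ _
  · simp only [pull_apply, List.map_append, List.map_cons]
    exact hc.1.2 _ _ _
  · obtain ⟨h1, h2⟩ := hc.2 _ hl
    refine ⟨by simpa using h1, hσ _ ?_⟩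
    convert h2
    ext; simp

end altChains

end ListChain

/-! ### Commuting operators in characteristic `p` -/

namespace ListChain

variable {k : Type*} [Field k] {p : ℕ} {ι : Type*} [Fintype ι]
  {W W' : Type*} [AddCommGroup W] [Module k W] [AddCommGroup W'] [Module k W']

lemma sum_pow_prime_of_commute [Fact p.Prime] [CharP k p] {x : ι → Module.End k W} (h : ∀ i j, Commute (x i) (x j)) :
    (∑ i, x i) ^ p = ∑ i, x i ^ p := by
  classical
  rcases subsingleton_or_nontrivial W with hW | hW
  · ext w
    exact Subsingleton.elim _ _
  have : CharP (Module.End k W) p :=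
    charP_of_injective_algebraMap (FaithfulSMul.algebraMap_injective k (Module.End k W)) p
  induction (Finset.univ : Finset ι) using Finset.induction_on with
  | empty => simp [(Fact.out : p.Prime).ne_zero]
  | insert i s hi ih =>
    rw [Finset.sum_insert hi, Finset.sum_insert hi, ← ih]
    exact add_pow_char_of_commute _ (Commute.sum_right _ _ _ fun j _ => h i j)

/-- The operator `∑ i, a i • (ρ i - 1)` attached to a family of operators `ρ`. -/
def twist (a : ι → k) (ρ : ι → Module.End k W) : Module.End k W := ∑ i, a i • (ρ i - 1)

lemma twist_pow [Fact p.Prime] [CharP k p] (a : ι → k) {ρ : ι → Module.End k W}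
    (hcomm : ∀ i j, Commute (ρ i) (ρ j))
    (hρ : ∀ i, ρ i ^ p = 1) : twist a ρ ^ p = 0 := by
  have hc : ∀ i j, Commute (ρ i - 1) (ρ j - 1) := fun i j =>
    ((hcomm i j).sub_right (Commute.one_right _)).sub_left (Commute.one_left _)
  rw [twist, sum_pow_prime_of_commute fun i j => ((hc i j).smul_left _).smul_right _]
  refine Finset.sum_eq_zero fun i _ => ?_
  rcases subsingleton_or_nontrivial W with hW | hW
  · ext w
    exact Subsingleton.elim _ _
  have : CharP (Module.End k W) p :=
    charP_of_injective_algebraMap (FaithfulSMul.algebraMap_injective k (Module.End k W)) p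
  rw [smul_pow, sub_pow_char_of_commute _ (Commute.one_right _), hρ, one_pow, sub_self, smul_zero]

lemma map_twist (a : ι → k) {ρ : ι → Module.End k W} {ρ' : ι → Module.End k W'} (F : W →ₗ[k] W')
    (x : W) (h : ∀ i, F (ρ i x) = ρ' i (F x)) : F (twist a ρ x) = twist a ρ' (F x) := by
  simp [twist, h]

lemma twist_mem {a : ι → k} {ρ : ι → Module.End k W} {S : Submodule k W}
    (h : ∀ i, ∀ x ∈ S, ρ i x ∈ S) {x : W} (hx : x ∈ S) : twist a ρ x ∈ S := by
  simp only [twist, LinearMap.sum_apply, LinearMap.smul_apply, LinearMap.sub_apply,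
    Module.End.one_apply]
  exact S.sum_mem fun i _ => S.smul_mem _ (S.sub_mem (h i x hx) hx)

lemma pow_apply_mem {t : Module.End k W} {S : Submodule k W} (h : ∀ x ∈ S, t x ∈ S) (n : ℕ)
    {x : W} (hx : x ∈ S) : (t ^ n) x ∈ S := by
  induction n with
  | zero => simpa
  | succ n ih => rw [pow_succ', Module.End.mul_apply]; exact h _ ih

/-- The two differentials of the periodic resolution of a `p`-nilpotent operator. -/
def periodic (p : ℕ) (t : Module.End k W) (m : ℕ) : Module.End k W :=
  if Even m then t ^ (p - 1) else t

lemma periodic_mem {t : Module.End k W} {S : Submodule k W} (h : ∀ x ∈ S, t x ∈ S) (m : ℕ)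
    {x : W} (hx : x ∈ S) : periodic p t m x ∈ S := by
  unfold periodic
  split_ifs
  exacts [pow_apply_mem h _ hx, h x hx]

lemma periodic_periodic [Fact p.Prime] {t : Module.End k W} (ht : t ^ p = 0) (m : ℕ) (x : W) :
    periodic p t (m + 1) (periodic p t m x) = 0 := by
  have hp := (Fact.out : p.Prime).pos
  have h1 : t * t ^ (p - 1) = 0 := by rw [← pow_succ', Nat.sub_add_cancel hp, ht]
  have h2 : t ^ (p - 1) * t = 0 := by rw [← pow_succ, Nat.sub_add_cancel hp, ht]
  by_cases hm : Even m
  · simp only [periodic, hm, Nat.even_add_one, not_true, if_true, if_false]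
    exact LinearMap.congr_fun h1 x
  · simp only [periodic, hm, Nat.even_add_one, not_false_iff, if_true, if_false]
    exact LinearMap.congr_fun h2 x

lemma map_periodic {t : Module.End k W} {t' : Module.End k W'} (F : W →ₗ[k] W')
    {S : Submodule k W} (hS : ∀ x ∈ S, t x ∈ S) (h : ∀ x ∈ S, F (t x) = t' (F x)) (m : ℕ) {x : W}
    (hx : x ∈ S) : F (periodic p t m x) = periodic p t' m (F x) := by
  unfold periodic
  split_ifs
  · induction p - 1 with
    | zero => simp
    | succ n ih =>
      rw [pow_succ', pow_succ', Module.End.mul_apply, Module.End.mul_apply,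
        h _ (pow_apply_mem hS n hx), ih]
  · exact h x hx

section freeness

variable {t δ U : Module.End k W} {S : Submodule k W}

lemma mul_pow_succ_of_commutator (hδt : δ * t = t * δ + U) (hUt : Commute U t) (j : ℕ) :
    δ * t ^ (j + 1) = t ^ (j + 1) * δ + (j + 1 : k) • (t ^ j * U) := by
  induction j with
  | zero => simp [hδt]
  | succ j ih =>
    have h1 : t ^ j * U * t = t ^ (j + 1) * U := by rw [mul_assoc, hUt.eq, ← mul_assoc, ← pow_succ]
    rw [pow_succ, ← mul_assoc, ih, add_mul, mul_assoc, hδt, smul_mul_assoc, h1, mul_add,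
      ← mul_assoc, ← pow_succ]
    push_cast
    module

lemma cast_succ_ne_zero [CharP k p] {j : ℕ} (hj : j + 1 < p) : (j + 1 : k) ≠ 0 := by
  intro h
  have : p ∣ j + 1 := (CharP.cast_eq_zero_iff k p (j + 1)).1 (by exact_mod_cast h)
  exact absurd (Nat.le_of_dvd (by omega) this) (by omega)

/-- If `U = δ t - t δ` commutes with `t` and `U ^ p = 1`, the kernel of `t ^ j` lies in the range
of `t` for `j < p`. -/
lemma exists_eq_of_pow_eq_zero [CharP k p] (hδt : δ * t = t * δ + U) (hUt : Commute U t)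
    (hS : ∀ x ∈ S, t x ∈ S) (hδ : ∀ x ∈ S, δ x ∈ S) (hU : ∀ x ∈ S, U x ∈ S)
    (hUp : ∀ x ∈ S, (U ^ p) x = x) {j : ℕ} (hj : j < p) {x : W} (hx : x ∈ S)
    (h : (t ^ j) x = 0) : ∃ y ∈ S, t y = x := by
  induction j generalizing x with
  | zero => exact ⟨0, S.zero_mem, by simpa using h.symm⟩
  | succ j ih =>
    have hc := cast_succ_ne_zero (k := k) hj
    have h1 := LinearMap.congr_fun (mul_pow_succ_of_commutator hδt hUt j) x
    simp only [Module.End.mul_apply, LinearMap.add_apply, LinearMap.smul_apply, h, map_zero] at h1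
    obtain ⟨y, hy, hy'⟩ := ih (by omega)
      (S.add_mem (S.smul_mem (j + 1 : k) (hU x hx)) (hS _ (hδ x hx))) (by
        rw [map_add, map_smul, ← Module.End.mul_apply (t ^ j) t, ← pow_succ, add_comm, ← h1])
    have h2 : U x = t ((j + 1 : k)⁻¹ • (y - δ x)) := by
      rw [map_smul, map_sub, hy', add_sub_cancel_right, smul_smul, inv_mul_cancel₀ hc, one_smul]
    refine ⟨(U ^ (p - 1)) ((j + 1 : k)⁻¹ • (y - δ x)),
      pow_apply_mem hU _ (S.smul_mem _ (S.sub_mem hy (hδ x hx))), ?_⟩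
    rw [← Module.End.mul_apply, ← (hUt.pow_left _).eq, Module.End.mul_apply, ← h2,
      ← Module.End.mul_apply, ← pow_succ, Nat.sub_add_cancel (by omega), hUp x hx]

/-- If `U = δ t - t δ` commutes with `t` and `U ^ p = 1`, the kernel of `t` lies in the range
of `t ^ j` for `j < p`. -/
lemma exists_pow_eq_of_eq_zero [CharP k p] (hδt : δ * t = t * δ + U) (hUt : Commute U t)
    (hδ : ∀ x ∈ S, δ x ∈ S) (hU : ∀ x ∈ S, U x ∈ S)
    (hUp : ∀ x ∈ S, (U ^ p) x = x) {j : ℕ} (hj : j < p) {x : W} (hx : x ∈ S)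
    (h : t x = 0) : ∃ y ∈ S, (t ^ j) y = x := by
  induction j with
  | zero => exact ⟨x, hx, by simp⟩
  | succ j ih =>
    have hc := cast_succ_ne_zero (k := k) hj
    obtain ⟨w, hw, hw'⟩ := ih (by omega)
    have h1 := LinearMap.congr_fun (mul_pow_succ_of_commutator hδt hUt j) w
    have h0 : (t ^ (j + 1)) w = 0 := by rw [pow_succ', Module.End.mul_apply, hw', h]
    rw [← (hUt.pow_right j).eq] at h1
    simp only [Module.End.mul_apply, LinearMap.add_apply, LinearMap.smul_apply, h0, map_zero,
      hw'] at h1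
    have h2 : U x = (t ^ (j + 1)) (-(j + 1 : k)⁻¹ • δ w) := by
      rw [map_smul, eq_neg_of_add_eq_zero_left h1.symm, neg_smul, smul_neg, neg_neg, smul_smul,
        inv_mul_cancel₀ hc, one_smul]
    refine ⟨(U ^ (p - 1)) (-(j + 1 : k)⁻¹ • δ w),
      pow_apply_mem hU _ (S.smul_mem _ (hδ w hw)), ?_⟩
    rw [← Module.End.mul_apply, ← ((hUt.pow_left _).pow_right _).eq, Module.End.mul_apply, ← h2,
      ← Module.End.mul_apply, ← pow_succ, Nat.sub_add_cancel (by omega), hUp x hx]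

/-- Exactness of the periodic resolution. -/
lemma exists_periodic_eq [Fact p.Prime] [CharP k p] (hδt : δ * t = t * δ + U) (hUt : Commute U t)
    (hS : ∀ x ∈ S, t x ∈ S) (hδ : ∀ x ∈ S, δ x ∈ S)
    (hUp : ∀ x ∈ S, (U ^ p) x = x) (m : ℕ) {x : W} (hx : x ∈ S)
    (h : periodic p t (m + 1) x = 0) : ∃ y ∈ S, periodic p t m y = x := by
  have hp := (Fact.out : p.Prime).pos
  have hU : ∀ x ∈ S, U x ∈ S := fun x hx => by
    rw [eq_sub_of_add_eq' hδt.symm]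
    exact S.sub_mem (hδ _ (hS x hx)) (hS _ (hδ x hx))
  by_cases hm : Even m
  · simp only [periodic, hm, Nat.even_add_one, not_true, if_true, if_false] at h ⊢
    exact exists_pow_eq_of_eq_zero hδt hUt hδ hU hUp (by omega) hx h
  · simp only [periodic, hm, Nat.even_add_one, not_false_iff, if_true, if_false] at h ⊢
    exact exists_eq_of_pow_eq_zero hδt hUt hS hδ hU hUp (by omega) hx h

end freeness

/-! ### Translation-equivariant cocycles -/

/-- Every set with an action of `(ZMod p)^r` carries a function whose increments in the coordinate
directions are invariant, normalized wherever the action is nontrivial. -/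
lemma exists_cocycle [Fact p.Prime] {r : ℕ} [Algebra (ZMod p) k] {a : Fin r → k}
    (ha : LinearIndependent (ZMod p) a) (X : Type*) [AddAction (Fin r → ZMod p) X] :
    ∃ (ψ : X → k) (φ : X → (Fin r → ZMod p) →+ k),
      (∀ (g : Fin r → ZMod p) x, ψ (g +ᵥ x) = ψ x + φ x g) ∧
      (∀ (g : Fin r → ZMod p) x, φ (g +ᵥ x) = φ x) ∧
      ∀ x, AddAction.stabilizer (Fin r → ZMod p) x ≠ ⊤ → ∑ i, a i * φ x (Pi.single i 1) = 1 := by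
  set G := Fin r → ZMod p
  have key : ∀ x : X, ∃ ℓ : G →+ k, (∀ g : G, g +ᵥ x = x → ℓ g = 0) ∧
      (AddAction.stabilizer G x ≠ ⊤ → ∑ i, a i * ℓ (Pi.single i 1) = 1) := by
    intro x
    by_cases hx : AddAction.stabilizer G x = ⊤
    · exact ⟨0, by simp, by simp [hx]⟩
    set H := AddSubgroup.toZModSubmodule p (AddAction.stabilizer G x)
    have hH : H < ⊤ := by
      rw [lt_top_iff_ne_top]
      intro h
      refine hx (SetLike.ext fun g => ?_)
      have := SetLike.ext_iff.1 h g
      simpa [H] using this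
    obtain ⟨ℓ, hℓ, hker⟩ := Submodule.exists_le_ker_of_lt_top H hH
    set c : k := ∑ i, a i * algebraMap (ZMod p) k (ℓ (Pi.single i 1))
    have hc : c ≠ 0 := by
      intro hc
      refine hℓ ((Pi.basisFun (ZMod p) (Fin r)).ext fun i => ?_)
      have := Fintype.linearIndependent_iff.1 ha (fun i => ℓ (Pi.single i 1)) (by
        simpa [c, Algebra.smul_def, mul_comm] using hc) i
      simpa using this
    refine ⟨(AddMonoidHom.mulLeft c⁻¹).comp
      ((algebraMap (ZMod p) k : ZMod p →+ k).comp ℓ.toAddMonoidHom), fun g hg => ?_, fun _ => ?_⟩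
    · have : ℓ g = 0 := hker (show g ∈ H by simpa [H] using hg)
      simp [this]
    · have : ∑ i, a i * (c⁻¹ * algebraMap (ZMod p) k (ℓ (Pi.single i 1))) = c⁻¹ * c := by
        simp only [c, Finset.mul_sum]
        exact Finset.sum_congr rfl fun i _ => by ring
      simpa [inv_mul_cancel₀ hc] using this
  choose ℓ hℓ hℓ1 using key
  let rep : X → X := fun x => (Quotient.mk (AddAction.orbitRel G X) x).out
  have hrep : ∀ (g : G) x, rep (g +ᵥ x) = rep x := fun g x => by
    refine congrArg Quotient.out (Quotient.sound (s := AddAction.orbitRel G X) ?_)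
    exact ⟨g, rfl⟩
  have hγ : ∀ x, ∃ g : G, g +ᵥ rep x = x := fun x => by
    have h : AddAction.orbitRel G X (rep x) x :=
      Quotient.exact (s := AddAction.orbitRel G X) (Quotient.out_eq _)
    exact (AddAction.orbitRel G X).symm h
  choose γ hγ using hγ
  refine ⟨fun x => ℓ (rep x) (γ x), fun x => ℓ (rep x), fun g x => ?_, fun g x => by
    simp only [hrep], fun x hx => hℓ1 _ fun h => hx ?_⟩
  · have h : ℓ (rep x) (-(g + γ x) + γ (g +ᵥ x)) = 0 := by
      refine hℓ _ _ ?_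
      have h1 := hγ (g +ᵥ x)
      rw [hrep] at h1
      rw [add_vadd, h1, neg_vadd_eq_iff, add_vadd, hγ]
    simp only [hrep]
    rw [map_add, map_neg, map_add] at h
    linear_combination h
  · refine SetLike.ext fun g => ⟨fun _ => AddSubgroup.mem_top g, fun hg => ?_⟩
    rw [← h, AddAction.mem_stabilizer_iff] at hg
    rw [AddAction.mem_stabilizer_iff, ← hγ x, vadd_comm, hg]

end ListChain

/-! ### Translations -/

namespace ListChain

section shift

variable {κ G : Type*} [AddCommGroup G]

/-- Translation of the second coordinate. -/
def shift (g : G) : κ × G ≃ κ × G := (Equiv.refl κ).prodCongr (Equiv.addLeft g)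

@[simp] lemma shift_apply (g : G) (v : κ × G) : shift g v = (v.1, g + v.2) := rfl

@[simp] lemma shift_symm_apply (g : G) (v : κ × G) : (shift g).symm v = (v.1, -g + v.2) := rfl

lemma map_shift_map_shift (g h : G) (l : List (κ × G)) :
    (l.map (shift h)).map (shift g) = l.map (shift (g + h)) := by
  simp [Function.comp_def, add_assoc]

lemma map_shift_zero (l : List (κ × G)) : l.map (shift (0 : G)) = l := by
  have : ⇑(shift (0 : G) : κ × G ≃ κ × G) = id := by ext v <;> simp
  rw [this, List.map_id]

/-- Translation action on finite sets. -/
abbrev shiftAction [DecidableEq κ] [DecidableEq G] : AddAction G (Finset (κ × G)) where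
  vadd g S := S.map (shift g).toEmbedding
  zero_vadd S := by
    change S.map (shift (0 : G)).toEmbedding = S
    ext; simp
  add_vadd g h S := by
    change S.map (shift (g + h)).toEmbedding =
      (S.map (shift h).toEmbedding).map (shift g).toEmbedding
    rw [Finset.map_map]
    congr 1
    ext v <;> simp [add_assoc]

variable {k : Type*} [Field k]

lemma commute_pull_shift (g h : G) :
    Commute (pull k (shift g : κ × G → κ × G)) (pull k (shift h)) := by
  ext c l
  simp only [Module.End.mul_apply, pull_apply, map_shift_map_shift, add_comm]

lemma pull_shift_pow (g : G) (n : ℕ) :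
    pull k (shift g : κ × G → κ × G) ^ n = pull k (shift (n • g)) := by
  induction n with
  | zero => ext c l; rw [zero_nsmul, pull_apply, map_shift_zero, pow_zero, Module.End.one_apply]
  | succ n ih =>
    ext c l
    rw [pow_succ, ih, Module.End.mul_apply, pull_apply, pull_apply, pull_apply,
      map_shift_map_shift, succ_nsmul']

lemma commute_push_shift (g h : G) : Commute (push (shift g) : Module.End k (List (κ × G) →₀ k))
    (push (shift h)) := by
  ext l : 2
  simp only [LinearMap.coe_comp, Function.comp_apply, Module.End.mul_apply, Finsupp.lsingle_apply,
    push_single, map_shift_map_shift, add_comm]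

lemma push_shift_pow (g : G) (n : ℕ) :
    (push (shift g) : Module.End k (List (κ × G) →₀ k)) ^ n = push (shift (n • g)) := by
  induction n with
  | zero =>
    ext l : 2
    rw [LinearMap.comp_apply, LinearMap.comp_apply, Finsupp.lsingle_apply, zero_nsmul, push_single,
      map_shift_zero, pow_zero, Module.End.one_apply]
  | succ n ih =>
    ext l : 2
    rw [pow_succ, ih, LinearMap.comp_apply, LinearMap.comp_apply, Finsupp.lsingle_apply,
      Module.End.mul_apply, push_single, push_single, push_single, map_shift_map_shift, succ_nsmul]

end shift

lemma mulByFinset_pow {k Ω : Type*} [Field k] [DecidableEq Ω] (ψ : Finset Ω → k) (n : ℕ) :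
    mulByFinset k ψ ^ n = mulByFinset k (ψ ^ n) := by
  induction n with
  | zero => ext c l; simp [mulByFinset_apply]
  | succ n ih =>
    ext c l
    simp [pow_succ, ih, mulByFinset_apply, mul_assoc]

/-- The sets of vertices that contain no full row. -/
def properRows (κ G : Type*) : Set (Finset (κ × G)) := {S | ∀ c, ∃ g, (c, g) ∉ S}

lemma properRows_mono {κ G : Type*} {S T : Finset (κ × G)} (hS : S ∈ properRows κ G) (hT : T ⊆ S) :
    T ∈ properRows κ G := fun c => (hS c).imp fun _ hg h => hg (hT h)

lemma card_le_of_mem_properRows {κ G : Type*} [Fintype κ] [Fintype G] [DecidableEq κ]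
    [DecidableEq G] {S : Finset (κ × G)} (hS : S ∈ properRows κ G) :
    S.card ≤ Fintype.card κ * (Fintype.card G - 1) := by
  choose g hg using hS
  have hsub : S ⊆ Finset.univ \ Finset.univ.image fun c => (c, g c) := by
    intro v hv
    simp only [Finset.mem_sdiff, Finset.mem_univ, Finset.mem_image, true_and, not_exists]
    rintro c rfl
    exact hg c hv
  refine (Finset.card_le_card hsub).trans ?_
  rw [Finset.card_sdiff_of_subset (Finset.subset_univ _), Finset.card_image_of_injective _
    fun c c' h => congrArg Prod.fst h, Finset.card_univ, Finset.card_univ, Fintype.card_prod,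
    Nat.mul_sub_one]

lemma image_shift_mem_properRows {κ G : Type*} [AddCommGroup G] [DecidableEq κ] [DecidableEq G]
    (g : G) {S : Finset (κ × G)} (h : S.image (shift g) ∈ properRows κ G) :
    S ∈ properRows κ G := by
  intro c
  obtain ⟨x, hx⟩ := h c
  refine ⟨-g + x, fun hm => hx (Finset.mem_image.2 ⟨_, hm, by simp⟩)⟩

/-- The elementary abelian group of rank `r`. -/
abbrev Vec (p r : ℕ) := Fin r → ZMod p

section resolution

variable {k : Type*} [Field k] {p : ℕ} {r : ℕ} {κ : Type*}

/-- The nilpotent operator on functions on lists. -/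
def pullTwist (p : ℕ) (a : Fin r → k) : Module.End k (List (κ × Vec p r) → k) :=
  twist a fun i => pull k (shift (-Pi.single i 1))

/-- The nilpotent operator on chains. -/
noncomputable def pushTwist (p : ℕ) (a : Fin r → k) :
    Module.End k (List (κ × Vec p r) →₀ k) :=
  twist a fun i => push (shift (Pi.single i 1))

lemma pullTwist_apply (a : Fin r → k) (c : List (κ × Vec p r) → k) (l) :
    pullTwist p a c l = ∑ i, a i * (c (l.map (shift (-Pi.single i 1))) - c l) := by
  simp [pullTwist, twist, pull_apply]

lemma pushTwist_pow [Fact p.Prime] [CharP k p] (a : Fin r → k) :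
    pushTwist (κ := κ) p a ^ p = 0 := by
  refine twist_pow a (fun i j => commute_push_shift _ _) fun i => ?_
  rw [push_shift_pow]
  have : p • (Pi.single i 1 : Vec p r) = 0 := by ext; simp
  rw [this]
  ext l : 2
  rw [LinearMap.comp_apply, LinearMap.comp_apply, Finsupp.lsingle_apply, push_single,
    map_shift_zero, Module.End.one_apply]

lemma sumHead_pullTwist [Fact p.Prime] [Fintype κ] (a : Fin r → k) (c : List (κ × Vec p r) → k) :
    sumHead k (pullTwist p a c) = pullTwist p a (sumHead k c) := by
  refine map_twist a _ c fun i => ?_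
  ext l
  simp only [sumHead_apply, pull_apply, List.map_cons]
  exact Fintype.sum_equiv (shift _) _ _ fun v => rfl

variable [DecidableEq κ]

lemma pullTwist_mem {m : ℕ} (a : Fin r → k) {c : List (κ × Vec p r) → k}
    (hc : c ∈ altChains k (properRows κ (Vec p r)) m) :
    pullTwist p a c ∈ altChains k (properRows κ (Vec p r)) m :=
  twist_mem (fun _ _ hx => pull_mem_altChains (fun _ => image_shift_mem_properRows _) hx) hc

/-- The alternating chains on the complex of sets without full rows form an exact periodic
sequence in positive degrees. -/
lemma exists_periodic_pullTwist_eq [Fact p.Prime] [CharP k p] [Algebra (ZMod p) k] {a : Fin r → k}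
    (ha : LinearIndependent (ZMod p) a) (j : ℕ) {m : ℕ} (hm : m ≠ 0)
    {c : List (κ × Vec p r) → k}
    (hc : c ∈ altChains k (properRows κ (Vec p r)) m)
    (h : periodic p (pullTwist p a) (j + 1) c = 0) :
    ∃ c' ∈ altChains k (properRows κ (Vec p r)) m, periodic p (pullTwist p a) j c' = c := by
  let : AddAction (Vec p r) (Finset (κ × Vec p r)) := shiftAction
  have hv : ∀ (g : Vec p r) (l : List (κ × Vec p r)), (l.map (shift g)).toFinset = g +ᵥ l.toFinset := by
    intro g l
    change _ = l.toFinset.map (shift g).toEmbedding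
    ext v
    simp only [List.mem_toFinset, List.mem_map, Finset.mem_map, Equiv.coe_toEmbedding]
  obtain ⟨ψ, φ, hψ, hφ, h1⟩ := exists_cocycle (k := k) ha (Finset (κ × Vec p r))
  let U : Fin r → Module.End k (List (κ × Vec p r) → k) := fun i =>
    mulByFinset k (fun S => φ S (Pi.single i 1)) * pull k (shift (-Pi.single i 1))
  have hMpull : ∀ (ξ : Finset (κ × Vec p r) → k) (_ : ∀ (g : Vec p r) S, ξ (g +ᵥ S) = ξ S) (g : Vec p r),
      Commute (mulByFinset k ξ) (pull k (shift g)) := by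
    intro ξ hξ g
    ext c l
    simp only [Module.End.mul_apply, mulByFinset_apply, pull_apply, hv, hξ]
  have hMM : ∀ ξ ξ' : Finset (κ × Vec p r) → k, Commute (mulByFinset k ξ) (mulByFinset k ξ') := by
    intro ξ ξ'
    ext c l
    simp only [Module.End.mul_apply, mulByFinset_apply]
    ring
  have hUpull : ∀ i (g : Vec p r), Commute (U i) (pull k (shift g)) := fun i g =>
    (hMpull _ (fun g S => by rw [hφ]) g).mul_left (commute_pull_shift _ _)
  have hUM : ∀ i (ξ : Finset (κ × Vec p r) → k) (_ : ∀ (g : Vec p r) S, ξ (g +ᵥ S) = ξ S),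
      Commute (U i) (mulByFinset k ξ) := fun i ξ hξ =>
    (hMM _ _).mul_left (hMpull ξ hξ _).symm
  have hUU : ∀ i j, Commute (U i) (U j) := fun i j =>
    (hUM i _ fun g S => by rw [hφ]).mul_right (hUpull i _)
  refine exists_periodic_eq (δ := mulByFinset k ψ) (U := ∑ i, a i • U i) ?_ ?_
    (fun _ => pullTwist_mem a) (fun _ => mulByFinset_mem_altChains ψ) ?_ j hc h
  · ext c l
    simp only [Module.End.mul_apply, mulByFinset_apply, pullTwist_apply, LinearMap.add_apply,
      LinearMap.sum_apply, LinearMap.smul_apply, Pi.add_apply, Finset.sum_apply, Pi.smul_apply,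
      pull_apply, smul_eq_mul, Finset.mul_sum, ← Finset.sum_add_distrib, U]
    refine Finset.sum_congr rfl fun i _ => ?_
    have := hψ (Pi.single i 1) (-(Pi.single i 1 : Vec p r) +ᵥ l.toFinset)
    rw [vadd_neg_vadd, hφ] at this
    rw [hv, this]
    ring
  · exact Commute.sum_left _ _ _ fun i _ => Commute.sum_right _ _ _ fun j _ =>
      (((hUpull i _).sub_right (Commute.one_right _)).smul_left _).smul_right _
  · intro c hc
    ext l
    have hpow : ((∑ i, a i • U i) ^ p) c l =
        (∑ i, a i * φ l.toFinset (Pi.single i 1)) ^ p * c l := by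
      have hterm : ∀ i, ((a i • U i) ^ p) c l = (a i * φ l.toFinset (Pi.single i 1)) ^ p * c l := by
        intro i
        have : p • -(Pi.single i 1 : Vec p r) = 0 := by ext; simp
        rw [smul_pow, (hMpull _ (fun g S => by rw [hφ]) _).mul_pow, pull_shift_pow, this,
          mulByFinset_pow, LinearMap.smul_apply, Pi.smul_apply, Module.End.mul_apply,
          mulByFinset_apply, pull_apply, map_shift_zero, mul_pow, smul_eq_mul, Pi.pow_apply,
          mul_assoc]
      rw [sum_pow_prime_of_commute fun i j => ((hUU i j).smul_left _).smul_right _,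
        LinearMap.sum_apply, Finset.sum_apply, sum_pow_char, Finset.sum_mul]
      exact Finset.sum_congr rfl fun i _ => hterm i
    rw [hpow]
    by_cases hl : c l = 0
    · rw [hl, mul_zero]
    obtain ⟨hlen, hK⟩ := hc.2 l hl
    rw [h1 _ fun htop => ?_, one_pow, one_mul]
    obtain ⟨v, hv'⟩ := List.exists_mem_of_ne_nil l (by rintro rfl; exact hm hlen.symm)
    obtain ⟨g, hg⟩ := hK v.1
    have hst : (g - v.2) +ᵥ l.toFinset = l.toFinset := by
      rw [← AddAction.mem_stabilizer_iff, htop]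
      exact AddSubgroup.mem_top _
    refine hg ?_
    rw [← hst, ← hv, List.mem_toFinset, List.mem_map]
    exact ⟨v, hv', by simp⟩

/-- There is no equivariant sequence of alternating chains that starts with the augmentation
generator and ends above the dimension of the complex of sets without full rows. -/
theorem false_of_sumHead_eq_periodic [Fact p.Prime] [CharP k p] [Algebra (ZMod p) k] [Fintype κ]
    {a : Fin r → k} (ha : LinearIndependent (ZMod p) a) {N : ℕ} (hN : 1 ≤ N)
    (hcard : Fintype.card κ * (p ^ r - 1) ≤ N) {y : ℕ → (List (κ × Vec p r) → k)}
    (hy : ∀ m ≤ N + 1, y m ∈ altChains k (properRows κ (Vec p r)) m)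
    (h0 : sumHead k (y 1) = y 0)
    (hs : ∀ m, 1 ≤ m → m ≤ N → sumHead k (y (m + 1)) = periodic p (pullTwist p a) m (y m))
    (hne : y 0 [] ≠ 0) : False := by
  set A := altChains k (properRows κ (Vec p r))
  have hK : ∀ S ∈ properRows κ (Vec p r), ∀ T ⊆ S, T ∈ properRows κ (Vec p r) :=
    fun S hS T => properRows_mono hS
  have hcomm : ∀ m (c : List (κ × Vec p r) → k), sumHead k (periodic p (pullTwist p a) m c) =
      periodic p (pullTwist p a) m (sumHead k c) := fun m c =>
    map_periodic _ (S := ⊤) (fun _ _ => trivial) (fun c _ => sumHead_pullTwist a c) m trivial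
  have htop : y (N + 1) = 0 := by
    refine eq_zero_of_mem_altChains (fun S hS => ?_) (hy (N + 1) le_rfl)
    have := card_le_of_mem_properRows hS
    simp only [Fintype.card_pi, ZMod.card, Finset.prod_const, Finset.card_univ,
      Fintype.card_fin] at this
    omega
  have key : ∀ j m, m + 1 + j = N → ∃ w ∈ A (m + 2), ∃ w' ∈ A (m + 1),
      y (m + 1) = sumHead k w + periodic p (pullTwist p a) m w' := by
    intro j
    induction j with
    | zero =>
      intro m hm
      obtain rfl : m + 1 = N := hm
      have h := hs (m + 1) (by omega) le_rfl
      rw [htop, map_zero] at h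
      obtain ⟨w', hw', h'⟩ := exists_periodic_pullTwist_eq ha m (Nat.succ_ne_zero m)
        (hy (m + 1) (by omega)) h.symm
      exact ⟨0, Submodule.zero_mem _, w', hw', by rw [map_zero, zero_add, h']⟩
    | succ j ih =>
      intro m hm
      obtain ⟨w, hw, w', hw', h⟩ := ih (m + 1) (by omega)
      have h1 := hs (m + 1) (by omega) (by omega)
      rw [h, map_add, sumHead_sumHead hw.1, zero_add, hcomm] at h1
      obtain ⟨w'', hw'', h2⟩ := exists_periodic_pullTwist_eq ha m (Nat.succ_ne_zero m)
        (Submodule.sub_mem _ (hy (m + 1) (by omega)) (sumHead_mem_altChains hK hw'))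
        (by rw [map_sub, h1, sub_self])
      exact ⟨w', hw', w'', hw'', by rw [h2, add_sub_cancel]⟩
  obtain ⟨w, hw, w', hw', h⟩ := key (N - 1) 0 (by omega)
  rw [zero_add] at h
  rw [h, map_add, sumHead_sumHead hw.1, zero_add, hcomm] at h0
  refine hne ?_
  obtain ⟨n, hn⟩ : ∃ n, p - 1 = n + 1 :=
    ⟨p - 2, by have := (Fact.out : p.Prime).two_le; omega⟩
  rw [← h0, periodic, if_pos (by simp), hn, pow_succ', Module.End.mul_apply, pullTwist_apply]
  simp

end resolution

end ListChain

/-! ### The deleted join constrained by a matching -/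

namespace ListChain

section family

variable {ι G : Type*}

/-- Two vertices are compatible when they agree if they lie in the same row, and do not lie in the
same column if their distinct rows are joined by an edge of `M`. -/
def Compat (M : Finset (Finset ι)) (v w : ι × G) : Prop :=
  (v.1 = w.1 → v.2 = w.2) ∧ ∀ e ∈ M, v.1 ∈ e → w.1 ∈ e → v.2 = w.2 → v.1 = w.1

variable {M : Finset (Finset ι)}

lemma Compat.refl (v : ι × G) : Compat M v v := ⟨fun _ => rfl, fun _ _ _ _ _ => rfl⟩

lemma Compat.symm {v w : ι × G} (h : Compat M v w) : Compat M w v :=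
  ⟨fun hr => (h.1 hr.symm).symm, fun e he hw hv hc => (h.2 e he hv hw hc.symm).symm⟩

lemma Compat.shift [AddCommGroup G] {v w : ι × G} (h : Compat M v w) (g : G) :
    Compat M (shift g v) (shift g w) :=
  ⟨fun hr => congrArg (g + ·) (h.1 hr),
    fun e he hv hw hc => h.2 e he hv hw (add_left_cancel hc)⟩

lemma compat_of_not_mem {v w : ι × G} (hne : w.1 ≠ v.1) (h : ∀ e ∈ M, v.1 ∈ e → w.1 ∉ e) :
    Compat M v w :=
  ⟨fun hr => absurd hr.symm hne, fun e he hv hw _ => absurd hw (h e he hv)⟩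

/-- The lists of pairwise compatible vertices contain a translation-invariant family that is exact
below the number of rows. -/
lemma exists_exact_family (k : Type*) [Field k] [DecidableEq ι] [AddCommGroup G] [Fintype G]
    [DecidableEq G] (hG : 2 < Fintype.card G) (hM2 : ∀ e ∈ M, e.card = 2)
    (hMdisj : ∀ e ∈ M, ∀ e' ∈ M, e ≠ e' → Disjoint e e') (R : Finset ι)
    (hR : ∀ e ∈ M, ∀ u ∈ e, u ∈ R → e ⊆ R) :
    ∃ L : Set (List (ι × G)), [] ∈ L ∧ (∀ (g : G), ∀ l ∈ L, l.map (shift g) ∈ L) ∧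
      (∀ l ∈ L, ∀ v ∈ l, v.1 ∈ R) ∧ (∀ l ∈ L, l.Pairwise (Compat M)) ∧
      ∀ m < R.card, ExactAt k L m := by
  induction R using Finset.strongInduction with
  | H R ih =>
  rcases R.eq_empty_or_nonempty with rfl | ⟨u, hu⟩
  · exact ⟨{[]}, by simp⟩
  by_cases hue : ∃ e ∈ M, u ∈ e
  · obtain ⟨e, he, hue⟩ := hue
    obtain ⟨v, hev, hvu⟩ : ∃ v ∈ e, v ≠ u := Finset.exists_mem_ne (by rw [hM2 e he]; norm_num) u
    have hedge : ∀ e' ∈ M, ∀ x ∈ e, x ∈ e' → e' = e := by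
      intro e' he' x hx hx'
      by_contra hne
      exact Finset.disjoint_left.1 (hMdisj e' he' e he hne) hx' hx
    obtain ⟨L, hnil, hL, hrow, hcompat, hex⟩ := ih (R \ e)
      (Finset.sdiff_ssubset (hR e he u hue hu) ⟨u, hue⟩) (by
        intro e' he' x hx hxR
        rw [Finset.mem_sdiff] at hxR
        refine Finset.subset_sdiff.2 ⟨hR e' he' x hx hxR.1, hMdisj e' he' e he ?_⟩
        rintro rfl
        exact hxR.2 hx)
    have hrow' : ∀ x ∈ e, ∀ g : G, ∀ l ∈ L, ∀ w ∈ l, w ≠ (x, g) := by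
      rintro x hx g l hl w hw rfl
      exact (Finset.mem_sdiff.1 (hrow l hl _ hw)).2 hx
    have hout : ∀ x ∈ e, ∀ g : G, ∀ l ∈ L, ∀ w ∈ l, Compat M (x, g) w := by
      intro x hx g l hl w hw
      have hwe := (Finset.mem_sdiff.1 (hrow l hl w hw)).2
      refine compat_of_not_mem (fun h => hwe (h ▸ hx)) fun e' he' hx' => ?_
      rwa [hedge e' he' x hx hx']
    have hRu := hu
    have hRv := hR e he u hue hu hev
    refine ⟨joinChessboard (fun g => (u, g)) (fun g => (v, g)) L, Or.inl (Or.inl hnil), ?_, ?_, ?_,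
      fun m hm => exactAt_joinChessboard (fun g h hgh => congrArg Prod.snd hgh)
        (fun g h hgh => congrArg Prod.snd hgh) (fun g h hgh => hvu (congrArg Prod.fst hgh).symm)
        (fun l hl w hw g => hrow' u hue g l hl w hw) (fun l hl w hw g => hrow' v hev g l hl w hw)
        hG hex ?_⟩
    · rintro g l ((hl | ⟨i, -, l, hl, rfl⟩) | ⟨i, -, l, (hl | ⟨j, hj, l, hl, rfl⟩), rfl⟩)
      · exact Or.inl (Or.inl (hL g l hl))
      · exact Or.inl (Or.inr ⟨g + i, Finset.mem_univ _, _, hL g l hl, rfl⟩)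
      · exact Or.inr ⟨g + i, Finset.mem_univ _, _, Or.inl (hL g l hl), rfl⟩
      · exact Or.inr ⟨g + i, Finset.mem_univ _, _,
          Or.inr ⟨g + j, by simpa using hj, _, hL g l hl, rfl⟩, rfl⟩
    · have hsub : ∀ l ∈ L, ∀ w ∈ l, w.1 ∈ R := fun l hl w hw =>
        (Finset.mem_sdiff.1 (hrow l hl w hw)).1
      rintro l ((hl | ⟨i, -, l, hl, rfl⟩) | ⟨i, -, l, (hl | ⟨j, hj, l, hl, rfl⟩), rfl⟩)
      · exact hsub l hl
      · simp only [List.mem_cons, forall_eq_or_imp]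
        exact ⟨hRv, hsub l hl⟩
      · simp only [List.mem_cons, forall_eq_or_imp]
        exact ⟨hRu, hsub l hl⟩
      · simp only [List.mem_cons, forall_eq_or_imp]
        exact ⟨hRu, hRv, hsub l hl⟩
    · rintro l ((hl | ⟨i, -, l, hl, rfl⟩) | ⟨i, -, l, (hl | ⟨j, hj, l, hl, rfl⟩), rfl⟩)
      · exact hcompat l hl
      · exact List.pairwise_cons.2 ⟨hout v hev i l hl, hcompat l hl⟩
      · exact List.pairwise_cons.2 ⟨hout u hue i l hl, hcompat l hl⟩
      · refine List.pairwise_cons.2 ⟨?_, List.pairwise_cons.2 ⟨hout v hev j l hl, hcompat l hl⟩⟩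
        simp only [List.mem_cons, forall_eq_or_imp]
        refine ⟨⟨fun h => absurd h.symm hvu, fun _ _ _ _ h => ?_⟩, hout u hue i l hl⟩
        exact absurd h.symm (Finset.ne_of_mem_erase hj)
    · rw [Finset.card_sdiff_of_subset (hR e he u hue hu), hM2 e he]
      omega
  · push Not at hue
    obtain ⟨L, hnil, hL, hrow, hcompat, hex⟩ := ih (R.erase u) (Finset.erase_ssubset hu) (by
      intro e he x hx hxR
      exact Finset.subset_erase.2 ⟨hR e he x hx (Finset.mem_of_mem_erase hxR), hue e he⟩)
    have hrow' : ∀ l ∈ L, ∀ w ∈ l, w.1 ≠ u := fun l hl w hw =>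
      Finset.ne_of_mem_erase (hrow l hl w hw)
    have hsub : ∀ l ∈ L, ∀ w ∈ l, w.1 ∈ R := fun l hl w hw =>
      Finset.mem_of_mem_erase (hrow l hl w hw)
    refine ⟨attach Finset.univ (fun g => (u, g)) L fun _ => L, Or.inl hnil, ?_, ?_, ?_,
      fun m hm => exactAt_join_points (fun g _ h _ hgh => congrArg Prod.snd hgh) ⟨0, by simp⟩
        (fun l hl w hw g _ h => hrow' l hl w hw (congrArg Prod.fst h)) hex ?_⟩
    · rintro g l (hl | ⟨i, -, l, hl, rfl⟩)
      · exact Or.inl (hL g l hl)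
      · exact Or.inr ⟨g + i, Finset.mem_univ _, _, hL g l hl, rfl⟩
    · rintro l (hl | ⟨i, -, l, hl, rfl⟩)
      · exact hsub l hl
      · simp only [List.mem_cons, forall_eq_or_imp]
        exact ⟨hu, hsub l hl⟩
    · rintro l (hl | ⟨i, -, l, hl, rfl⟩)
      · exact hcompat l hl
      · exact List.pairwise_cons.2 ⟨fun w hw => compat_of_not_mem (hrow' l hl w hw)
          fun e he h => absurd h (hue e he), hcompat l hl⟩
    · rwa [Finset.card_erase_add_one hu]

end family

lemma pushTwist_mem_chains {k : Type*} [Field k] {p r : ℕ} {κ : Type*} (a : Fin r → k)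
    {L : Set (List (κ × Vec p r))} (hL : ∀ (g : Vec p r), ∀ l ∈ L, l.map (shift g) ∈ L) {m : ℕ}
    {x : List (κ × Vec p r) →₀ k} (hx : x ∈ chains k L m) : pushTwist p a x ∈ chains k L m :=
  twist_mem (fun _ _ hx => map_mem_of_supported (s := {l | l ∈ L ∧ l.length = m}) _
    (fun l hl => by
      rw [push_single]
      exact Finsupp.single_mem_supported k _ ⟨hL _ l hl.1, by simpa using hl.2⟩) hx) hx

/-- An exact translation-invariant family carries an equivariant sequence of chains starting with
the augmentation generator. -/
lemma exists_resolution {k : Type*} [Field k] {p r : ℕ} [Fact p.Prime] [CharP k p] {κ : Type*}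
    (a : Fin r → k) {L : Set (List (κ × Vec p r))} (hnil : [] ∈ L)
    (hL : ∀ (g : Vec p r), ∀ l ∈ L, l.map (shift g) ∈ L) {n : ℕ}
    (hex : ∀ m < n, ExactAt k L m) :
    ∃ x : ℕ → (List (κ × Vec p r) →₀ k), x 0 = Finsupp.single [] 1 ∧
      (∀ m ≤ n, x m ∈ chains k L m) ∧ (0 < n → bd (x 1) = x 0) ∧
      ∀ m, 1 ≤ m → m < n → bd (x (m + 1)) = periodic p (pushTwist p a) m (x m) := by
  let T : Module.End k (List (κ × Vec p r) →₀ k) := pushTwist p a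
  have hTbd : ∀ m x, bd (periodic p T m x) = periodic p T m (bd x) := fun m x =>
    map_periodic _ (S := ⊤) (fun _ _ => trivial)
      (fun c _ => map_twist a _ c fun i => bd_push _ _) m trivial
  let E : ℕ → Module.End k (List (κ × Vec p r) →₀ k) := fun m =>
    if m = 0 then 1 else periodic p T m
  have hEE : ∀ m, ∀ x ∈ chains k L m, E (m + 1) (E m x) = 0 := by
    intro m x hx
    rcases m.eq_zero_or_pos with rfl | hm
    · refine eq_of_supported (F := E (0 + 1) ∘ₗ E 0) (F' := 0) (fun l hl => ?_) hx
      obtain rfl : l = [] := List.length_eq_zero_iff.1 hl.2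
      simp [E, periodic, T, pushTwist, twist]
    · simp only [E, hm.ne', Nat.succ_ne_zero, if_false]
      exact periodic_periodic (pushTwist_pow a) m x
  have hEmem : ∀ m, ∀ x ∈ chains k L m, E m x ∈ chains k L m := by
    intro m x hx
    by_cases hm : m = 0
    · simpa [E, hm] using hx
    · simpa only [E, hm, if_false] using periodic_mem
        (fun _ => pushTwist_mem_chains a hL) m hx
  have hEbd : ∀ m x, bd (E (m + 1) x) = E (m + 1) (bd x) := fun m x => by
    simpa only [E, Nat.succ_ne_zero, if_false] using hTbd (m + 1) x
  let P : ℕ → (List (κ × Vec p r) →₀ k) → Prop := fun m x => x ∈ chains k L m ∧ bd (E m x) = 0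
  have hstep : ∀ m x, ∃ w, m < n → P m x → P (m + 1) w ∧ bd w = E m x := by
    intro m x
    by_cases h : m < n ∧ P m x
    · obtain ⟨w, hw, hbw⟩ := hex m h.1 _ (hEmem m x h.2.1) h.2.2
      exact ⟨w, fun _ _ => ⟨⟨hw, by rw [hEbd, hbw, hEE m x h.2.1]⟩, hbw⟩⟩
    · exact ⟨0, fun h1 h2 => absurd ⟨h1, h2⟩ h⟩
  choose next hnext using hstep
  let x : ℕ → (List (κ × Vec p r) →₀ k) := fun m => Nat.rec (Finsupp.single [] 1) next m
  have hP : ∀ m ≤ n, P m (x m) := by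
    intro m
    induction m with
    | zero =>
      exact fun _ => ⟨Finsupp.single_mem_supported k _ ⟨hnil, rfl⟩, by
        simp [E, x, bd_single, bdList]⟩
    | succ m ih => exact fun hm => (hnext m (x m) hm (ih (by omega))).1
  have hbd : ∀ m < n, bd (x (m + 1)) = E m (x m) := fun m hm =>
    (hnext m (x m) hm (hP m hm.le)).2
  exact ⟨x, rfl, fun m hm => (hP m hm).1, fun h => by simpa [E] using hbd 0 h, fun m hm hmn => by
    simpa only [E, Nat.ne_of_gt hm, if_false] using hbd m hmn⟩

end ListChain

/-! ### Equivariant labelings of the constrained deleted join -/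

namespace ListChain

/-- The realization of the complex of pairwise compatible vertices. -/
def deletedJoin {ι : Type*} (M : Finset (Finset ι)) (G : Type*) [Fintype ι] [Fintype G] :
    Set (ι × G → ℝ) :=
  {x | x ∈ stdSimplex ℝ (ι × G) ∧ ∀ v w, x v ≠ 0 → x w ≠ 0 → Compat M v w}

/-- Translation of points of the deleted join. -/
def shiftPoint {ι G : Type*} [AddCommGroup G] (g : G) : (ι × G → ℝ) →ₗ[ℝ] (ι × G → ℝ) :=
  LinearMap.funLeft ℝ ℝ (shift g).symm

lemma shiftPoint_apply {ι G : Type*} [AddCommGroup G] (g : G) (x : ι × G → ℝ) (v : ι × G) :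
    shiftPoint g x v = x (v.1, -g + v.2) := rfl

lemma shiftPoint_single {ι G : Type*} [AddCommGroup G] [DecidableEq ι] [DecidableEq G] (g : G)
    (v : ι × G) : shiftPoint g (Pi.single v 1) = Pi.single (shift g v) 1 := by
  ext w
  rw [shiftPoint_apply]
  by_cases h : w = shift g v
  · subst h
    simp
  · rw [Pi.single_eq_of_ne h, Pi.single_eq_of_ne]
    rintro rfl
    exact h (by simp)

lemma shiftPoint_mem {ι G : Type*} [AddCommGroup G] [Fintype ι] [Fintype G]
    {M : Finset (Finset ι)} (g : G) {x : ι × G → ℝ} (hx : x ∈ deletedJoin M G) :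
    shiftPoint g x ∈ deletedJoin M G := by
  refine ⟨⟨fun v => hx.1.1 _, ?_⟩, fun v w hv hw => ?_⟩
  · rw [← hx.1.2]
    exact Fintype.sum_equiv (shift g).symm _ _ fun v => rfl
  · simpa using (hx.2 _ _ hv hw).shift g

lemma dist_le_one_of_mem_stdSimplex {V : Type*} [Fintype V] {x y : V → ℝ}
    (hx : x ∈ stdSimplex ℝ V) (hy : y ∈ stdSimplex ℝ V) : dist x y ≤ 1 := by
  refine (dist_pi_le_iff zero_le_one).2 fun v => ?_
  have h1 : x v ≤ 1 := by
    rw [← hx.2]; exact Finset.single_le_sum (fun w _ => hx.1 w) (Finset.mem_univ v)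
  have h2 : y v ≤ 1 := by
    rw [← hy.2]; exact Finset.single_le_sum (fun w _ => hy.1 w) (Finset.mem_univ v)
  have h3 := hx.1 v
  have h4 := hy.1 v
  rw [Real.dist_eq, abs_le]
  constructor <;> linarith

/-- An equivariant labeling of the constrained deleted join has small sets of points of a common
simplex whose labels contain a full row. -/
theorem false_of_labeling {p r : ℕ} [Fact p.Prime] (hr : r ≠ 0) (hpr : 2 < p ^ r)
    {ι κ : Type*} [Fintype ι] [DecidableEq ι] [Fintype κ] [DecidableEq κ] {M : Finset (Finset ι)}
    (hM2 : ∀ e ∈ M, e.card = 2) (hMdisj : ∀ e ∈ M, ∀ e' ∈ M, e ≠ e' → Disjoint e e')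
    {N : ℕ} (hN : 1 ≤ N) (hι : Fintype.card ι = N + 1) (hκ : Fintype.card κ * (p ^ r - 1) ≤ N)
    (lab : (ι × Vec p r → ℝ) → κ × Vec p r)
    (hlab : ∀ (g : Vec p r), ∀ x ∈ deletedJoin M (Vec p r),
      lab (shiftPoint g x) = shift g (lab x))
    {δ : ℝ} (hδ : 0 < δ)
    (hsmall : ∀ l : List (ι × Vec p r → ℝ), (∀ x ∈ l, x ∈ deletedJoin M (Vec p r)) →
      (∀ x ∈ l, ∀ y ∈ l, dist x y < δ) →
      (l.map lab).toFinset ∈ properRows κ (Vec p r)) : False := by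
  let k := GaloisField p r
  have hcardG : Fintype.card (Vec p r) = p ^ r := by simp [ZMod.card]
  obtain ⟨a, ha⟩ : ∃ a : Fin r → k, LinearIndependent (ZMod p) a :=
    ⟨_, (Module.finBasisOfFinrankEq (ZMod p) k (GaloisField.finrank p hr)).linearIndependent⟩
  obtain ⟨L, hnil, hL, -, hcompat, hex⟩ := exists_exact_family (G := Vec p r) k
    (by rwa [hcardG]) hM2 hMdisj Finset.univ fun e _ u _ _ => Finset.subset_univ e
  rw [Finset.card_univ, hι] at hex
  obtain ⟨x, hx0, hxmem, hbd0, hbd⟩ := exists_resolution a hnil hL hex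
  obtain ⟨j, hj⟩ : ∃ j : ℕ, (N / (N + 1) : ℝ) ^ j < δ :=
    exists_pow_lt_of_lt_one hδ (by rw [div_lt_one (by positivity)]; linarith)
  let vert : ι × Vec p r → (ι × Vec p r → ℝ) := fun v => Pi.single v 1
  let Φ : (List (ι × Vec p r) →₀ k) →ₗ[k] (List (κ × Vec p r) → k) :=
    alt ∘ₗ push lab ∘ₗ (sd ^ j) ∘ₗ push vert
  have hΦbd : ∀ z, sumHead k (Φ z) = Φ (bd z) := by
    intro z
    simp only [Φ, LinearMap.comp_apply]
    rw [sumHead_alt, bd_push, bd_sd_pow, bd_push]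
  have hfine : ∀ m ≤ N + 1, ∀ z ∈ chains k L m, ((sd ^ j) : Module.End k _) (push vert z) ∈ Finsupp.supported k k
      {l | l.length = m ∧ (∀ x ∈ l, x ∈ deletedJoin M (Vec p r)) ∧
        ∀ x ∈ l, ∀ y ∈ l, dist x y < δ} := by
    intro m hm z hz
    refine map_mem_of_supported ((sd ^ j) ∘ₗ push vert) (fun l hl => ?_) hz
    rw [LinearMap.comp_apply, push_single]
    let C : Set (ι × Vec p r → ℝ) :=
      stdSimplex ℝ (ι × Vec p r) ∩ {x | ∀ v, v ∉ l → x v = 0}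
    have hC : Convex ℝ C := by
      refine (convex_stdSimplex ℝ _).inter fun x hx y hy s t _ _ _ v hv => ?_
      simp [hx v hv, hy v hv]
    have hCsub : C ⊆ deletedJoin M (Vec p r) := by
      refine fun x hx => ⟨hx.1, fun v w hv hw => ?_⟩
      have hmem : ∀ v, x v ≠ 0 → v ∈ l := fun v hv => by
        by_contra h
        exact hv (hx.2 v h)
      have : Std.Symm (Compat (G := Vec p r) M) := ⟨fun _ _ h => h.symm⟩
      exact (hcompat l hl.1).forall_of_forall (fun v _ => Compat.refl v) (hmem v hv) (hmem w hw)
    have hvert : ∀ x ∈ l.map vert, x ∈ C := by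
      intro x hx
      obtain ⟨v, hv, rfl⟩ := List.mem_map.1 hx
      refine ⟨single_mem_stdSimplex ℝ v, fun w hw => Pi.single_eq_of_ne ?_ _⟩
      rintro rfl
      exact hw hv
    refine Finsupp.supported_mono ?_ (sd_iterate_mem_small (n := N) hC (D := 1)
      (by simpa [hl.2] using hm) hvert
      (fun x hx y hy => dist_le_one_of_mem_stdSimplex (hvert x hx).1 (hvert y hy).1) j)
    rintro l' ⟨h1, h2, h3⟩
    refine ⟨by rw [h1, List.length_map, hl.2], fun x hx => hCsub (h2 x hx), fun x hx y hy => ?_⟩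
    exact (h3 x hx y hy).trans_lt (by simpa using hj)
  have hΦT : ∀ m ≤ N + 1, ∀ z ∈ chains k L m, Φ (pushTwist p a z) = pullTwist p a (Φ z) := by
    intro m hm z hz
    refine map_twist a Φ z fun i => ?_
    ext l
    have h1 : push vert (push (shift (Pi.single i 1)) z) =
        push (shiftPoint (Pi.single i 1)) (push vert z) := by
      refine eq_of_supported (F := push vert ∘ₗ push (shift (Pi.single i 1)))
        (F' := push (shiftPoint (Pi.single i 1)) ∘ₗ push vert) (fun l _ => ?_) hz
      simp only [LinearMap.comp_apply, push_single, List.map_map]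
      congr 2
      ext v : 1
      exact (shiftPoint_single _ v).symm
    have h2 : push lab (push (shiftPoint (Pi.single i 1)) (((sd ^ j) : Module.End k _) (push vert z))) =
        push (shift (Pi.single i 1)) (push lab (((sd ^ j) : Module.End k _) (push vert z))) := by
      refine eq_of_supported (F := push lab ∘ₗ push (shiftPoint (Pi.single i 1)))
        (F' := push (shift (Pi.single i 1)) ∘ₗ push lab) (fun l hl => ?_) (hfine m hm z hz)
      simp only [LinearMap.comp_apply, push_single, List.map_map]
      congr 1
      exact List.map_congr_left fun x hx => hlab _ x (hl.2.1 x hx)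
    simp only [Φ, LinearMap.comp_apply]
    rw [h1, sd_pow_push, h2, alt_push]
    rfl
  refine false_of_sumHead_eq_periodic ha hN hκ (y := fun m => Φ (x m)) (fun m hm => ?_) ?_
    (fun m hm hmN => ?_) ?_
  · refine map_mem_of_supported (alt ∘ₗ push lab) (fun l hl => ?_) (hfine m hm _ (hxmem m hm))
    rw [LinearMap.comp_apply, push_single, alt_single]
    have := altList_mem_altChains (k := k) (hsmall l hl.2.1 hl.2.2)
    rwa [List.length_map, hl.1] at this
  · rw [hΦbd, hbd0 (by omega)]
  · rw [hΦbd, hbd m hm (by omega)]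
    exact map_periodic Φ (fun _ => pushTwist_mem_chains a hL) (hΦT m (by omega)) m (hxmem m (by omega))
  · simp only [hx0, Φ, LinearMap.comp_apply]
    rw [push_single, List.map_nil, sd_pow_nil, push_single, List.map_nil, alt_single]
    simp [altList]

end ListChain

/-! ### Zeros of equivariant maps on the constrained deleted join -/

namespace ListChain

lemma isCompact_deletedJoin {ι G : Type*} [Fintype ι] [Fintype G] (M : Finset (Finset ι)) :
    IsCompact (deletedJoin M G) := by
  have hclosed : IsClosed {x : ι × G → ℝ | ∀ v w, ¬ Compat M v w → x v = 0 ∨ x w = 0} := by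
    simp only [Set.ofPred_forall]
    refine isClosed_iInter fun v => isClosed_iInter fun w => isClosed_iInter fun _ => ?_
    exact (isClosed_eq (continuous_apply v) continuous_const).union
      (isClosed_eq (continuous_apply w) continuous_const)
  convert (isCompact_stdSimplex ℝ (ι × G)).inter_right hclosed using 1
  ext x
  refine and_congr_right fun _ => forall_congr' fun v => forall_congr' fun w => ?_
  tauto

/-- On the deleted join there is an equivariant choice of a column. -/
lemma exists_column {ι G : Type*} [AddCommGroup G] [Fintype ι] [Fintype G]
    (M : Finset (Finset ι)) : ∃ col : (ι × G → ℝ) → G, ∀ (g : G), ∀ x ∈ deletedJoin M G,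
      col (shiftPoint g x) = g + col x := by
  classical
  let rows : (ι × G → ℝ) → Set ι := fun x => {u | ∃ h, x (u, h) ≠ 0}
  have hrows : ∀ (g : G) x, rows (shiftPoint g x) = rows x := by
    intro g x
    ext u
    constructor
    · rintro ⟨h, hh⟩
      exact ⟨_, hh⟩
    · rintro ⟨h, hh⟩
      exact ⟨g + h, by rwa [shiftPoint_apply, neg_add_cancel_left]⟩
  have hne : ∀ x ∈ deletedJoin M G, (rows x).Nonempty := by
    intro x hx
    by_contra hempty
    have h0 : ∀ v, x v = 0 := fun v => by
      by_contra hv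
      exact hempty ⟨v.1, v.2, hv⟩
    have := hx.1.2
    simp [h0] at this
  have hsel : ∀ R : Set ι, ∃ u : Option ι, R.Nonempty → ∃ u' ∈ R, u = some u' := by
    intro R
    by_cases hR : R.Nonempty
    · exact ⟨some hR.some, fun _ => ⟨_, hR.some_mem, rfl⟩⟩
    · exact ⟨none, fun h => absurd h hR⟩
  choose sel hsel using hsel
  have hcol : ∀ x : ι × G → ℝ, ∃ h : G, x ∈ deletedJoin M G →
      ∃ u, sel (rows x) = some u ∧ x (u, h) ≠ 0 := by
    intro x
    by_cases hx : x ∈ deletedJoin M G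
    · obtain ⟨u, ⟨h, hh⟩, hu⟩ := hsel _ (hne x hx)
      exact ⟨h, fun _ => ⟨u, hu, hh⟩⟩
    · exact ⟨0, fun h => absurd h hx⟩
  choose col hcol using hcol
  refine ⟨col, fun g x hx => ?_⟩
  obtain ⟨u, hu, hxu⟩ := hcol x hx
  obtain ⟨u', hu', hxu'⟩ := hcol _ (shiftPoint_mem g hx)
  rw [hrows, hu, Option.some_inj] at hu'
  subst hu'
  have this : col x = -g + col (shiftPoint g x) := (hx.2 _ _ hxu hxu').1 rfl
  rw [this, add_neg_cancel_left]

/-- An equivariant map from the constrained deleted join to a sum of reduced regular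
representations of dimension less than that of the join has a zero. -/
theorem exists_zero_of_equivariant {p r : ℕ} [Fact p.Prime] (hr : r ≠ 0) (hpr : 2 < p ^ r)
    {ι κ : Type*} [Fintype ι] [DecidableEq ι] [Fintype κ] [DecidableEq κ] [Nonempty κ]
    {M : Finset (Finset ι)} (hM2 : ∀ e ∈ M, e.card = 2)
    (hMdisj : ∀ e ∈ M, ∀ e' ∈ M, e ≠ e' → Disjoint e e')
    {N : ℕ} (hN : 1 ≤ N) (hι : Fintype.card ι = N + 1) (hκ : Fintype.card κ * (p ^ r - 1) ≤ N)
    {w : (ι × Vec p r → ℝ) → (κ × Vec p r → ℝ)} (hw : ContinuousOn w (deletedJoin M (Vec p r)))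
    (hequiv : ∀ g x, w (shiftPoint g x) = shiftPoint g (w x))
    (hsum : ∀ x c, ∑ g, w x (c, g) = 0) : ∃ x ∈ deletedJoin M (Vec p r), w x = 0 := by
  by_contra! hne
  have hpos : ∀ x ∈ deletedJoin M (Vec p r), ∃ v, 0 < w x v := by
    intro x hx
    by_contra! hle
    refine hne x hx (funext fun v => ?_)
    exact (Finset.sum_eq_zero_iff_of_nonpos fun g _ => hle (v.1, g)).1 (hsum x v.1) v.2
      (Finset.mem_univ _)
  have hcompact := isCompact_deletedJoin (G := Vec p r) M
  obtain ⟨ε, hε, hmax⟩ : ∃ ε > 0, ∀ x ∈ deletedJoin M (Vec p r),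
      ε ≤ Finset.univ.sup' Finset.univ_nonempty (w x) := by
    refine hcompact.exists_forall_le' ?_ fun x hx => ?_
    · exact ContinuousOn.finset_sup'_apply _ fun v _ => (continuousOn_pi.1 hw) v
    · obtain ⟨v, hv⟩ := hpos x hx
      exact hv.trans_le (Finset.le_sup' (w x) (Finset.mem_univ v))
  have hlab₀ : ∀ x, ∃ v, x ∈ deletedJoin M (Vec p r) → ε ≤ w x v := by
    intro x
    obtain ⟨v, -, hv⟩ := Finset.exists_mem_eq_sup' Finset.univ_nonempty (w x)
    exact ⟨v, fun hx => hv ▸ hmax x hx⟩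
  choose lab₀ hlab₀ using hlab₀
  obtain ⟨col, hcol⟩ := exists_column (G := Vec p r) M
  let lab : (ι × Vec p r → ℝ) → κ × Vec p r := fun x =>
    shift (col x) (lab₀ (shiftPoint (-col x) x))
  have hlab : ∀ x ∈ deletedJoin M (Vec p r), ε ≤ w x (lab x) := by
    intro x hx
    have h := hlab₀ _ (shiftPoint_mem (-col x) hx)
    rw [hequiv, shiftPoint_apply, neg_neg] at h
    exact h
  obtain ⟨δ, hδ, hδw⟩ := Metric.uniformContinuousOn_iff.1
    (hcompact.uniformContinuousOn_of_continuous hw) ε hε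
  refine false_of_labeling hr hpr hM2 hMdisj hN hι hκ lab (fun g x hx => ?_) hδ
    fun l hl hdist c => ?_
  · have h : shiftPoint (-(g + col x)) (shiftPoint g x) = shiftPoint (-col x) x := by
      ext v
      simp only [shiftPoint_apply]
      congr 2
      abel
    simp only [lab, hcol g x hx, h, shift_apply, add_assoc]
  · by_contra! hfull
    have hpt : ∀ g, ∃ x ∈ l, lab x = (c, g) := fun g => by
      simpa using hfull g
    obtain ⟨y, hy, -⟩ := hpt 0
    refine (Finset.sum_pos (fun g _ => ?_) Finset.univ_nonempty).ne' (hsum y c)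
    obtain ⟨x, hx, hxg⟩ := hpt g
    have h1 := hlab x (hl x hx)
    have h2 := (dist_le_pi_dist (w x) (w y) (lab x)).trans_lt
      (hδw x (hl x hx) y (hl y hy) (hdist x hx y hy))
    rw [Real.dist_eq, abs_lt] at h2
    rw [hxg] at h1 h2
    linarith

/-- The cone of a continuous map on the standard simplex is continuous. -/
lemma continuousOn_homogenization {ι E : Type*} [Fintype ι] [NormedAddCommGroup E]
    [NormedSpace ℝ E] {F : (ι → ℝ) → E} (hF : ContinuousOn F (stdSimplex ℝ ι)) :
    ContinuousOn (fun z => (∑ i, z i) • F ((∑ i, z i)⁻¹ • z)) {z | ∀ i, 0 ≤ z i} := by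
  have hmem : ∀ z : ι → ℝ, (∀ i, 0 ≤ z i) → ∑ i, z i ≠ 0 → (∑ i, z i)⁻¹ • z ∈ stdSimplex ℝ ι := by
    intro z hz hs
    refine ⟨fun i => mul_nonneg (inv_nonneg.2 (Finset.sum_nonneg fun i _ => hz i)) (hz i), ?_⟩
    simp only [Pi.smul_apply, smul_eq_mul, ← Finset.mul_sum]
    exact inv_mul_cancel₀ hs
  have hsumc : Continuous fun z : ι → ℝ => ∑ i, z i := by fun_prop
  intro z hz
  by_cases hs : ∑ i, z i = 0
  · obtain ⟨B, hB⟩ := (isCompact_stdSimplex ℝ ι).exists_bound_of_continuousOn hF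
    have hlim : Filter.Tendsto (fun z : ι → ℝ => (∑ i, z i) * B)
        (nhdsWithin z {z | ∀ i, 0 ≤ z i}) (nhds 0) := by
      have : Continuous fun z : ι → ℝ => (∑ i, z i) * B := by fun_prop
      have h := (this.tendsto z).mono_left (nhdsWithin_le_nhds (s := {z | ∀ i, 0 ≤ z i}))
      rwa [hs, zero_mul] at h
    have h0 : (∑ i, z i) • F ((∑ i, z i)⁻¹ • z) = 0 := by rw [hs, zero_smul]
    rw [ContinuousWithinAt, h0]
    refine squeeze_zero_norm' ?_ hlim
    filter_upwards [self_mem_nhdsWithin] with y hy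
    have hy0 : 0 ≤ ∑ i, y i := Finset.sum_nonneg fun i _ => hy i
    by_cases hys : ∑ i, y i = 0
    · simp [hys]
    · rw [norm_smul, Real.norm_of_nonneg hy0]
      exact mul_le_mul_of_nonneg_left (hB _ (hmem y hy hys)) hy0
  · have hset : {z : ι → ℝ | ∀ i, 0 ≤ z i} ∩ {z | ∑ i, z i ≠ 0} ∈
        nhdsWithin z {z | ∀ i, 0 ≤ z i} :=
      Filter.inter_mem self_mem_nhdsWithin
        (nhdsWithin_le_nhds ((isOpen_ne_fun hsumc continuous_const).mem_nhds hs))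
    have hcont : ContinuousOn (fun z : ι → ℝ => (∑ i, z i) • F ((∑ i, z i)⁻¹ • z))
        ({z : ι → ℝ | ∀ i, 0 ≤ z i} ∩ {z | ∑ i, z i ≠ 0}) := by
      refine hsumc.continuousOn.smul (hF.comp ?_ fun z hz => hmem z hz.1 hz.2)
      exact (hsumc.continuousOn.inv₀ fun z hz => hz.2).smul continuousOn_id
    exact (hcont z ⟨hz, hs⟩).mono_of_mem_nhdsWithin hset

end ListChain

namespace ListChain

/-- Subtracting from every row its mean, for functions on `κ × G`. -/
noncomputable def centerRows {κ G : Type*} [Fintype G] (y : κ × G → ℝ) : κ × G → ℝ :=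
  fun v => y v - (Fintype.card G : ℝ)⁻¹ * ∑ h, y (v.1, h)

lemma centerRows_shiftPoint {κ G : Type*} [Fintype G] [AddCommGroup G] (g : G)
    (y : κ × G → ℝ) : centerRows (shiftPoint g y) = shiftPoint g (centerRows y) := by
  ext v
  simp only [centerRows, shiftPoint_apply]
  rw [← Equiv.sum_comp (Equiv.addLeft (-g)) fun h => y (v.1, h)]
  rfl

lemma sum_centerRows {κ G : Type*} [Fintype G] [Nonempty G] (y : κ × G → ℝ) (c : κ) :
    ∑ g, centerRows y (c, g) = 0 := by
  simp [centerRows, Finset.sum_sub_distrib]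

lemma continuous_centerRows {κ G : Type*} [Fintype G] :
    Continuous (centerRows : (κ × G → ℝ) → κ × G → ℝ) := by
  unfold centerRows
  fun_prop

lemma eq_of_centerRows_eq_zero {κ G : Type*} [Fintype G] {y : κ × G → ℝ}
    (hy : centerRows y = 0) (c : κ) (g h : G) : y (c, g) = y (c, h) := by
  have hg := congr_fun hy (c, g)
  have hh := congr_fun hy (c, h)
  simp only [centerRows, Pi.zero_apply, sub_eq_zero] at hg hh
  rw [hg, hh]

/-- Equal weights and equal values of `F` on all normalized columns of some point of the
constrained deleted join. -/
theorem exists_balanced {p r : ℕ} [Fact p.Prime] (hr : r ≠ 0) (hpr : 2 < p ^ r)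
    {ι : Type*} [Fintype ι] [DecidableEq ι] {d N : ℕ}
    {M : Finset (Finset ι)} (hM2 : ∀ e ∈ M, e.card = 2)
    (hMdisj : ∀ e ∈ M, ∀ e' ∈ M, e ≠ e' → Disjoint e e')
    (hι : Fintype.card ι = N + 1) (hN : N = (d + 1) * (p ^ r - 1))
    {F : (ι → ℝ) → EuclideanSpace ℝ (Fin d)} (hF : ContinuousOn F (stdSimplex ℝ ι)) :
    ∃ x ∈ deletedJoin M (Vec p r), ∃ s ≠ 0, (∀ g, ∑ u, x (u, g) = s) ∧
      ∀ g h, F (s⁻¹ • fun u => x (u, g)) = F (s⁻¹ • fun u => x (u, h)) := by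
  let C : (ι → ℝ) → EuclideanSpace ℝ (Fin d) := fun z => (∑ i, z i) • F ((∑ i, z i)⁻¹ • z)
  let Ψ : (ι × Vec p r → ℝ) → (Option (Fin d) × Vec p r → ℝ) := fun x v =>
    v.1.elim (∑ u, x (u, v.2)) fun i => C (fun u => x (u, v.2)) i
  have hΨ : ContinuousOn Ψ (deletedJoin M (Vec p r)) := by
    refine continuousOn_pi.2 ?_
    rintro ⟨_ | i, g⟩
    · exact Continuous.continuousOn (by simp only [Ψ, Option.elim]; fun_prop)
    · have hC : ContinuousOn (fun x : ι × Vec p r → ℝ => C fun u => x (u, g))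
          (deletedJoin M (Vec p r)) :=
        (continuousOn_homogenization hF).comp (Continuous.continuousOn (by fun_prop))
          fun x hx u => hx.1.1 (u, g)
      exact (EuclideanSpace.proj (𝕜 := ℝ) i).continuous.comp_continuousOn hC
  have hN1 : 1 ≤ N := by
    rw [hN]
    exact Nat.mul_pos d.succ_pos (by omega)
  obtain ⟨x, hx, hx0⟩ := exists_zero_of_equivariant (κ := Option (Fin d)) hr hpr hM2 hMdisj
    hN1 hι (by simp [hN]) (w := fun x => centerRows (Ψ x))
    (continuous_centerRows.comp_continuousOn hΨ)
    (fun g x => centerRows_shiftPoint g (Ψ x)) fun x c => sum_centerRows (Ψ x) c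
  have hs : ∀ g, ∑ u, x (u, g) = ∑ u, x (u, 0) := fun g =>
    eq_of_centerRows_eq_zero hx0 none g 0
  have hs0 : ∑ u, x (u, 0) ≠ 0 := by
    intro h0
    have h1 := hx.1.2
    rw [Fintype.sum_prod_type_right] at h1
    simp [hs, h0] at h1
  refine ⟨x, hx, _, hs0, hs, fun g h => ?_⟩
  have hC : C (fun u => x (u, g)) = C fun u => x (u, h) := by
    ext i
    exact eq_of_centerRows_eq_zero hx0 (some i) g h
  simp only [C, hs] at hC
  exact smul_right_injective _ hs0 hC

end ListChain

/-- Topological Tverberg theorem with a matching as constraint graph: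
for a prime power q > 2 and N = (d+1)(q−1), given a matching M on the vertex
set of σ^N, every continuous map f : ‖σ^N‖ → ℝ^d has a Tverberg partition
into q pairwise disjoint faces not using any edge of M. -/
theorem tverberg_with_matching_constraints (p r q d N : ℕ)
    (hp : p.Prime) (hr : 1 ≤ r) (hq : q = p ^ r) (hq2 : 2 < q) (hd : 1 ≤ d)
    (hN : N = (d + 1) * (q - 1))
    (M : Finset (Finset (Fin (N + 1))))
    (hM2 : ∀ e ∈ M, e.card = 2)
    (hMdisj : ∀ e ∈ M, ∀ e' ∈ M, e ≠ e' → Disjoint e e')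
    (f : C(stdSimplex ℝ (Fin (N + 1)), EuclideanSpace ℝ (Fin d))) :
    ∃ F : Fin q → Finset (Fin (N + 1)),
      (Pairwise fun i j => Disjoint (F i) (F j)) ∧
      (⋂ i : Fin q, f '' faceRealization (F i)).Nonempty ∧
      (∀ i : Fin q, ∀ e ∈ M, ((F i) ∩ e).card ≤ 1) := by
  classical
  have : Fact p.Prime := ⟨hp⟩
  subst hq
  have hcard : Fintype.card (Fin (p ^ r)) = Fintype.card (ListChain.Vec p r) := by
    simp [ListChain.Vec, ZMod.card]
  let φ : Fin (p ^ r) ≃ ListChain.Vec p r := Fintype.equivOfCardEq hcard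
  let F : (Fin (N + 1) → ℝ) → EuclideanSpace ℝ (Fin d) := fun y =>
    if h : y ∈ stdSimplex ℝ (Fin (N + 1)) then f ⟨y, h⟩ else 0
  have hFf : ∀ y : stdSimplex ℝ (Fin (N + 1)), F y = f y := fun y => dif_pos y.2
  have hF : ContinuousOn F (stdSimplex ℝ (Fin (N + 1))) := by
    rw [continuousOn_iff_continuous_domRestrict]
    exact f.continuous.congr fun y => (hFf y).symm
  obtain ⟨x, hx, s, hs0, hs, heq⟩ := ListChain.exists_balanced (by omega) hq2 hM2 hMdisj
    (Fintype.card_fin _) hN hF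
  have hspos : 0 ≤ s := by
    rw [← hs 0]
    exact Finset.sum_nonneg fun u _ => hx.1.1 _
  let pt : ListChain.Vec p r → stdSimplex ℝ (Fin (N + 1)) := fun g =>
    ⟨s⁻¹ • fun u => x (u, g), fun u => mul_nonneg (inv_nonneg.2 hspos) (hx.1.1 _), by
      simp only [Pi.smul_apply, smul_eq_mul, ← Finset.mul_sum, hs g]
      exact inv_mul_cancel₀ hs0⟩
  refine ⟨fun i => Finset.univ.filter fun u => x (u, φ i) ≠ 0, fun i j hij => ?_,
    ⟨f (pt 0), Set.mem_iInter.2 fun i => ⟨pt (φ i), fun u hu => ?_, ?_⟩⟩, fun i e he => ?_⟩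
  · refine Finset.disjoint_left.2 fun u hi hj => hij (φ.injective ?_)
    exact (hx.2 (u, φ i) (u, φ j) (by simpa using hi) (by simpa using hj)).1 rfl
  · simpa using right_ne_zero_of_mul hu
  · rw [← hFf, ← hFf]
    exact heq _ _
  · refine Finset.card_le_one.2 fun u hu v hv => ?_
    simp only [Finset.mem_inter, Finset.mem_filter, Finset.mem_univ, true_and] at hu hv
    exact (hx.2 (u, φ i) (v, φ i) hu.1 hv.1).2 e he hu.2 hv.2 rfl
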